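/- arXiv:1002.4174 — 2 statements merged into one kernel-verified Lean document; each statement's English description precedes it below -/
import Mathlib

section
/- The series defining Brun's constant converges: the sum over all primes p such that p+2 is also prime of the quantity 1/p + 1/(p+2) is a convergent (summable) series of real numbers. -/
open Finset ArithmeticFunction
open scoped ArithmeticFunction.Moebius ArithmeticFunction.sigma

namespace BoundingSieve

/-- The truncated sum of the Selberg terms, whose inverse is the density in Selberg's bound. -/
noncomputable def selbergSum (s : BoundingSieve) (z : ℕ) : ℝ :=
  ∑ l ∈ s.prodPrimes.divisors with l ≤ z, s.selbergTerms l

/-- The weights in the Selberg sieve, truncated at `z`. -/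
noncomputable def selbergWeight (s : BoundingSieve) (z d : ℕ) : ℝ :=
  (s.nu d)⁻¹ * ((∑ l ∈ s.prodPrimes.divisors with l ≤ z,
    if d ∣ l then (μ (l / d) : ℝ) * (μ l * s.selbergTerms l) else 0) / s.selbergSum z)

/-- Dual Möbius inversion: only the term `l = m` survives. -/
theorem sum_divisors_moebius_div (l m : ℕ) (hm : m ≠ 0) :
    (∑ d ∈ m.divisors, if l ∣ d then (μ (m / d) : ℝ) else 0) = if l = m then 1 else 0 := by
  by_cases hlm : l ∣ m
  · obtain ⟨k, rfl⟩ := hlm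
    have hl : l ≠ 0 := left_ne_zero_of_mul hm
    have hk : k ≠ 0 := right_ne_zero_of_mul hm
    rw [← Nat.sum_div_divisors (l * k), ← sum_filter]
    have : (l * k).divisors.filter (fun d => l ∣ l * k / d) = k.divisors := by
      ext d
      simp only [mem_filter, Nat.mem_divisors]
      constructor
      · rintro ⟨⟨h1, -⟩, h2⟩
        refine ⟨?_, hk⟩
        have := (Nat.dvd_div_iff_mul_dvd h1).1 h2
        rw [mul_comm d l] at this
        exact Nat.dvd_of_mul_dvd_mul_left (Nat.pos_of_ne_zero hl) this
      · rintro ⟨h1, -⟩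
        have h3 : d ∣ l * k := h1.mul_left l
        refine ⟨⟨h3, hm⟩, (Nat.dvd_div_iff_mul_dvd h3).2 ?_⟩
        rw [mul_comm d l]
        exact Nat.mul_dvd_mul_left l h1
    rw [this]
    have h2 : ∀ d ∈ k.divisors, (μ (l * k / (l * k / d)) : ℝ) = μ d := by
      intro d hd
      rw [Nat.div_div_self ((Nat.dvd_of_mem_divisors hd).mul_left l) hm]
    rw [sum_congr rfl h2]
    have h3 := congrArg (fun f : ArithmeticFunction ℝ => f k)
      (coe_moebius_mul_coe_zeta (R := ℝ))
    simp only [coe_mul_zeta_apply, intCoe_apply, one_apply] at h3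
    rw [h3]
    congr 1
    simp [hl]
  · rw [if_neg (by rintro rfl; exact hlm dvd_rfl)]
    refine sum_eq_zero fun d hd => if_neg fun h => hlm (h.trans (Nat.dvd_of_mem_divisors hd))

variable {s : BoundingSieve} {z : ℕ}

theorem selbergSum_pos (hz : 1 ≤ z) : 0 < s.selbergSum z := by
  refine sum_pos (fun l hl => selbergTerms_pos ?_) ⟨1, ?_⟩
  · simp only [mem_filter, Nat.mem_divisors] at hl; exact hl.1.1
  · simp [hz, prodPrimes_ne_zero]

theorem moebius_mul_self_of_dvd {l : ℕ} (hl : l ∣ s.prodPrimes) : (μ l : ℝ) * μ l = 1 := by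
  have h := moebius_sq_eq_one_of_squarefree (squarefree_of_dvd_prodPrimes hl)
  rw [sq] at h
  exact_mod_cast h

theorem selbergWeight_one (hz : 1 ≤ z) : s.selbergWeight z 1 = 1 := by
  have : (∑ l ∈ s.prodPrimes.divisors with l ≤ z,
    if 1 ∣ l then (μ (l / 1) : ℝ) * (μ l * s.selbergTerms l) else 0) = s.selbergSum z := by
    refine sum_congr rfl fun l hl => ?_
    simp only [mem_filter, Nat.mem_divisors] at hl
    rw [if_pos (one_dvd _), Nat.div_one, ← mul_assoc, moebius_mul_self_of_dvd hl.1.1, one_mul]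
  rw [selbergWeight, this, s.nu_mult.map_one, div_self (selbergSum_pos hz).ne']
  simp

theorem selbergWeight_eq_zero {d : ℕ} (hd : z < d) : s.selbergWeight z d = 0 := by
  have : (∑ l ∈ s.prodPrimes.divisors with l ≤ z,
    if d ∣ l then (μ (l / d) : ℝ) * (μ l * s.selbergTerms l) else 0) = 0 := by
    refine sum_eq_zero fun l hl => if_neg fun h => ?_
    simp only [mem_filter, Nat.mem_divisors] at hl
    have := Nat.le_of_dvd (Nat.pos_of_dvd_of_pos hl.1.1
      (Nat.pos_of_ne_zero prodPrimes_ne_zero)) h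
    omega
  rw [selbergWeight, this]; simp

theorem abs_selbergWeight_le (hz : 1 ≤ z) {d : ℕ} (hd : d ∣ s.prodPrimes) :
    |s.selbergWeight z d| ≤ (s.nu d)⁻¹ * s.selbergTerms d := by
  have hS := selbergSum_pos (s := s) hz
  have hnu := nu_pos_of_dvd_prodPrimes hd
  have hg := selbergTerms_pos hd
  have hd0 : 0 < d := Nat.pos_of_dvd_of_pos hd (Nat.pos_of_ne_zero prodPrimes_ne_zero)
  rw [selbergWeight, abs_mul, abs_of_pos (inv_pos.2 hnu), abs_div, abs_of_pos hS]
  gcongr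
  rw [div_le_iff₀ hS]
  refine (abs_sum_le_sum_abs _ _).trans ?_
  calc _ ≤ ∑ l ∈ (s.prodPrimes.divisors.filter (· ≤ z)).filter (d ∣ ·),
        s.selbergTerms d * s.selbergTerms (l / d) := by
        rw [sum_filter (d ∣ ·)]
        refine sum_le_sum fun l hl => ?_
        simp only [mem_filter, Nat.mem_divisors] at hl
        split_ifs with h
        · obtain ⟨k, rfl⟩ := h
          have hco : d.Coprime k :=
            Nat.coprime_of_squarefree_mul (squarefree_of_dvd_prodPrimes hl.1.1)
          have hk := selbergTerms_pos ((dvd_mul_left k d).trans hl.1.1)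
          rw [Nat.mul_div_cancel_left k hd0, selbergTerms_isMultiplicative.map_mul_of_coprime hco,
            abs_mul, abs_mul, abs_of_pos (mul_pos hg hk)]
          have h1 : |(μ k : ℝ)| ≤ 1 := by exact_mod_cast abs_moebius_le_one
          have h2 : |(μ (d * k) : ℝ)| ≤ 1 := by exact_mod_cast abs_moebius_le_one
          calc _ ≤ 1 * (1 * (s.selbergTerms d * s.selbergTerms k)) := by gcongr
            _ = _ := by ring
        · simp
    _ = s.selbergTerms d * ∑ k ∈ ((s.prodPrimes.divisors.filter (· ≤ z)).filter (d ∣ ·)).image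
          (· / d), s.selbergTerms k := by
        rw [mul_sum, sum_image]
        intro a ha b hb hab
        simp only [coe_filter, mem_filter, Set.mem_ofPred_eq] at ha hb
        exact (Nat.div_left_inj ha.2 hb.2).1 hab
    _ ≤ s.selbergTerms d * s.selbergSum z := by
        gcongr
        refine sum_le_sum_of_subset_of_nonneg ?_ ?_
        · intro k hk
          simp only [mem_image, mem_filter, Nat.mem_divisors] at hk ⊢
          obtain ⟨l, ⟨⟨⟨h1, h2⟩, h3⟩, h4⟩, rfl⟩ := hk
          exact ⟨⟨(Nat.div_dvd_of_dvd h4).trans h1, h2⟩, (Nat.div_le_self _ _).trans h3⟩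
        · intro l hl _
          simp only [mem_filter, Nat.mem_divisors] at hl
          exact (selbergTerms_pos hl.1.1).le

/-- The weights diagonalise the quadratic form of the main sum. -/
theorem sum_nu_mul_selbergWeight {l : ℕ} (hl : l ∣ s.prodPrimes) :
    (∑ d ∈ s.prodPrimes.divisors, if l ∣ d then s.nu d * s.selbergWeight z d else 0) =
      if l ≤ z then μ l * s.selbergTerms l / s.selbergSum z else 0 := by
  have h1 : ∀ d ∈ s.prodPrimes.divisors,
      (if l ∣ d then s.nu d * s.selbergWeight z d else 0) =
      ∑ m ∈ s.prodPrimes.divisors with m ≤ z, (μ m * s.selbergTerms m / s.selbergSum z) *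
        (if d ∣ m then if l ∣ d then (μ (m / d) : ℝ) else 0 else 0) := by
    intro d hd
    have hnu := (nu_pos_of_dvd_prodPrimes (Nat.dvd_of_mem_divisors hd)).ne'
    split_ifs with h
    · rw [selbergWeight, mul_inv_cancel_left₀ hnu, sum_div]
      refine sum_congr rfl fun m _ => ?_
      split_ifs <;> ring
    · simp
  rw [sum_congr rfl h1, sum_comm]
  simp_rw [← mul_sum]
  have h2 : ∀ m ∈ s.prodPrimes.divisors.filter (· ≤ z),
      (μ m * s.selbergTerms m / s.selbergSum z) * (∑ d ∈ s.prodPrimes.divisors,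
        (if d ∣ m then if l ∣ d then (μ (m / d) : ℝ) else 0 else 0)) =
      if l = m then (μ m * s.selbergTerms m / s.selbergSum z) else 0 := by
    intro m hm
    simp only [mem_filter, Nat.mem_divisors] at hm
    rw [← sum_filter, Nat.divisors_filter_dvd_of_dvd prodPrimes_ne_zero hm.1.1,
      sum_divisors_moebius_div _ _ (ne_zero_of_dvd_ne_zero hm.1.2 hm.1.1)]
    split_ifs <;> simp
  rw [sum_congr rfl h2, sum_ite_eq]
  simp [hl, prodPrimes_ne_zero]

theorem mainSum_selbergWeight (hz : 1 ≤ z) :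
    s.mainSum (lambdaSquared (s.selbergWeight z)) = (s.selbergSum z)⁻¹ := by
  have hS := selbergSum_pos (s := s) hz
  rw [mainSum_lambdaSquared_eq_sum_mul_sum_sq]
  have h : ∀ l ∈ s.prodPrimes.divisors, (s.selbergTerms l)⁻¹ * (∑ d ∈ s.prodPrimes.divisors,
      if l ∣ d then s.nu d * s.selbergWeight z d else 0) ^ 2 =
      if l ≤ z then s.selbergTerms l / s.selbergSum z ^ 2 else 0 := by
    intro l hl
    have hl := Nat.dvd_of_mem_divisors hl
    have hg := (selbergTerms_pos hl).ne'
    have hμ := moebius_mul_self_of_dvd hl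
    rw [sum_nu_mul_selbergWeight hl]
    split_ifs
    · rw [div_pow, mul_pow, sq (μ l : ℝ), hμ]
      field_simp
    · simp
  rw [sum_congr rfl h, ← sum_filter, ← sum_div]
  change s.selbergSum z / _ = _
  field_simp

theorem abs_lambdaSquared_selbergWeight_le (hz : 1 ≤ z)
    (hw : ∀ d, d ∣ s.prodPrimes → (s.nu d)⁻¹ * s.selbergTerms d ≤ d) {d : ℕ}
    (hd : d ∣ s.prodPrimes) :
    |lambdaSquared (s.selbergWeight z) d| ≤ if d ≤ z ^ 2 then (z : ℝ) ^ 6 else 0 := by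
  have hd0 : 0 < d := Nat.pos_of_dvd_of_pos hd (Nat.pos_of_ne_zero prodPrimes_ne_zero)
  have hw' : ∀ e ∈ d.divisors, |s.selbergWeight z e| ≤ z := by
    intro e he
    have he := (Nat.dvd_of_mem_divisors he).trans hd
    rcases le_or_gt e z with h | h
    · exact (abs_selbergWeight_le hz he).trans ((hw e he).trans (by exact_mod_cast h))
    · rw [selbergWeight_eq_zero h]; simp
  split_ifs with h
  · have h2 : (#d.divisors : ℝ) ≤ z ^ 2 := by
      exact_mod_cast (Nat.card_divisors_le_self d).trans h
    calc _ ≤ ∑ d1 ∈ d.divisors, ∑ d2 ∈ d.divisors, (z : ℝ) * z := by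
          refine (abs_sum_le_sum_abs _ _).trans (sum_le_sum fun d1 h1 => ?_)
          refine (abs_sum_le_sum_abs _ _).trans (sum_le_sum fun d2 h2 => ?_)
          split_ifs
          · rw [abs_mul]
            exact mul_le_mul (hw' _ h1) (hw' _ h2) (abs_nonneg _) (by positivity)
          · simp only [abs_zero]; positivity
      _ = #d.divisors * (#d.divisors * ((z : ℝ) * z)) := by simp
      _ ≤ (z : ℝ) ^ 2 * ((z : ℝ) ^ 2 * (z * z)) := by gcongr
      _ = _ := by ring
  · apply le_of_eq
    rw [abs_eq_zero]
    refine sum_eq_zero fun d1 h1 => sum_eq_zero fun d2 h2 => ?_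
    split_ifs with h3
    · rcases le_or_gt d1 z with h4 | h4
      · rcases le_or_gt d2 z with h5 | h5
        · exfalso
          have h6 : d1.lcm d2 ≤ d1 * d2 := Nat.le_of_dvd (Nat.mul_pos
            (Nat.pos_of_mem_divisors h1) (Nat.pos_of_mem_divisors h2)) (Nat.lcm_dvd_mul _ _)
          have := Nat.mul_le_mul h4 h5
          rw [← sq] at this
          omega
        · rw [selbergWeight_eq_zero h5, mul_zero]
      · rw [selbergWeight_eq_zero h4, zero_mul]
    · rfl

/-- A crude form of the Selberg sieve, with a wasteful error term. -/
theorem siftedSum_le_div_selbergSum (hz : 1 ≤ z)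
    (hw : ∀ d, d ∣ s.prodPrimes → (s.nu d)⁻¹ * s.selbergTerms d ≤ d)
    (hr : ∀ d, d ∣ s.prodPrimes → |s.rem d| ≤ d) :
    s.siftedSum ≤ s.totalMass / s.selbergSum z + z ^ 10 := by
  refine (siftedSum_le_mainSum_errSum_of_upperMoebius (lambdaSquared (s.selbergWeight z))
    (upperMoebius_lambdaSquared _ (selbergWeight_one hz))).trans ?_
  rw [mainSum_selbergWeight hz, ← div_eq_mul_inv]
  gcongr
  rw [errSum]
  calc _ ≤ ∑ d ∈ s.prodPrimes.divisors, if d ≤ z ^ 2 then (z : ℝ) ^ 8 else 0 := by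
        refine sum_le_sum fun d hd => ?_
        have hd := Nat.dvd_of_mem_divisors hd
        have h1 := abs_lambdaSquared_selbergWeight_le hz hw hd
        split_ifs at h1 ⊢ with h
        · calc _ ≤ (z : ℝ) ^ 6 * z ^ 2 := by
                refine mul_le_mul h1 ((hr d hd).trans ?_) (abs_nonneg _) (by positivity)
                exact_mod_cast h
            _ = _ := by ring
        · rw [abs_nonpos_iff.1 h1]; simp
    _ ≤ ∑ d ∈ Icc 1 (z ^ 2), (z : ℝ) ^ 8 := by
        rw [← sum_filter]
        refine sum_le_sum_of_subset_of_nonneg ?_ fun _ _ _ => by positivity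
        intro d hd
        simp only [mem_filter] at hd
        exact mem_Icc.2 ⟨Nat.pos_of_mem_divisors hd.1, hd.2⟩
    _ = _ := by
        simp
        ring

end BoundingSieve

theorem sum_Icc_inv_sq_le (n : ℕ) : ∑ m ∈ Icc 1 n, ((m : ℝ) ^ 2)⁻¹ ≤ 2 := by
  have h := sum_Ioo_inv_sq_le (α := ℝ) 0 (n + 1)
  have h' : Ioo 0 (n + 1) = Icc 1 n := by ext; simp; omega
  simpa [h'] using h

theorem sum_le_sum_of_injOn {ι κ : Type*} [DecidableEq κ] {s : Finset ι} {t : Finset κ}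
    {f : ι → ℝ} {g : κ → ℝ} (e : ι → κ) (he : Set.InjOn e s) (hmem : ∀ i ∈ s, e i ∈ t)
    (hg : ∀ k ∈ t, 0 ≤ g k) (hfg : ∀ i ∈ s, f i ≤ g (e i)) : ∑ i ∈ s, f i ≤ ∑ k ∈ t, g k := by
  calc _ ≤ ∑ i ∈ s, g (e i) := sum_le_sum hfg
    _ = ∑ k ∈ s.image e, g k := (sum_image he).symm
    _ ≤ _ := sum_le_sum_of_subset_of_nonneg (image_subset_iff.2 hmem) fun k hk _ => hg k hk

/-- The odd squarefree natural numbers below `n`. -/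
def oddSquarefreeBelow (n : ℕ) : Finset ℕ := {a ∈ range n | Odd a ∧ Squarefree a}

theorem mem_oddSquarefreeBelow {n a : ℕ} :
    a ∈ oddSquarefreeBelow n ↔ a < n ∧ Odd a ∧ Squarefree a := by
  simp [oddSquarefreeBelow]

theorem log_le_sum_odd_inv (n : ℕ) :
    Real.log (n + 1) / 2 ≤ ∑ a ∈ range (2 * n) with Odd a, (a : ℝ)⁻¹ := by
  have h := log_add_one_le_harmonic n
  calc _ ≤ ((harmonic n : ℚ) : ℝ) / 2 := by gcongr; exact_mod_cast h
    _ = ∑ i ∈ range n, ((i : ℝ) + 1)⁻¹ / 2 := by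
        simp [harmonic, sum_div]
    _ ≤ _ := by
        refine sum_le_sum_of_injOn (fun i => 2 * i + 1) ?_ ?_ ?_ ?_
        · intro a _ b _ h; simpa using h
        · intro i hi
          simp only [mem_range, mem_filter] at hi ⊢
          exact ⟨by omega, by simp⟩
        · intros; positivity
        · intro i _
          rw [div_eq_mul_inv, ← mul_inv]
          push_cast
          gcongr
          linarith

theorem sum_odd_inv_le_two_mul (n : ℕ) :
    ∑ a ∈ range n with Odd a, (a : ℝ)⁻¹ ≤ 2 * ∑ a ∈ oddSquarefreeBelow n, (a : ℝ)⁻¹ := by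
  choose u v huv using Nat.sq_mul_squarefree
  calc _ ≤ ∑ p ∈ Icc 1 n ×ˢ oddSquarefreeBelow n, ((p.1 : ℝ) ^ 2)⁻¹ * (p.2 : ℝ)⁻¹ := by
        refine sum_le_sum_of_injOn (fun a => (v a, u a)) ?_ ?_ ?_ ?_
        · intro a _ b _ h
          simp only [Prod.mk.injEq] at h
          rw [← (huv a).1, ← (huv b).1, h.1, h.2]
        · intro a ha
          simp only [mem_range, mem_filter] at ha
          have h1 := (huv a).1
          have h2 : Odd (v a ^ 2 * u a) := by rw [h1]; exact ha.2
          rw [Nat.odd_mul] at h2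
          have h3 : v a ≠ 0 := by rintro h; simp [h] at h2
          have h4 : u a ≠ 0 := by rintro h; simp [h] at h2
          simp only [mem_product, mem_Icc, mem_oddSquarefreeBelow]
          refine ⟨⟨by omega, ?_⟩, ?_, h2.2, (huv a).2⟩
          · have : v a ≤ v a ^ 2 * u a := by
              calc v a ≤ v a * (v a * u a) := Nat.le_mul_of_pos_right _ (by positivity)
                _ = _ := by ring
            omega
          · have : u a ≤ v a ^ 2 * u a := Nat.le_mul_of_pos_left _ (by positivity)
            omega
        · intros; positivity
        · intro a _
          apply le_of_eq
          rw [← mul_inv]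
          congr 1
          exact_mod_cast (huv a).1.symm
    _ = (∑ m ∈ Icc 1 n, ((m : ℝ) ^ 2)⁻¹) * ∑ a ∈ oddSquarefreeBelow n, (a : ℝ)⁻¹ := by
        rw [sum_mul_sum, sum_product]
    _ ≤ _ := by
        gcongr
        exact sum_Icc_inv_sq_le n

theorem sq_sum_oddSquarefree_inv_le (n : ℕ) :
    (∑ a ∈ oddSquarefreeBelow n, (a : ℝ)⁻¹) ^ 2 ≤
      2 * ∑ l ∈ oddSquarefreeBelow (n ^ 2), (#l.divisors : ℝ) / l := by
  set Q := oddSquarefreeBelow n with hQ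
  calc _ = ∑ p ∈ Q ×ˢ Q, (p.1 : ℝ)⁻¹ * (p.2 : ℝ)⁻¹ := by
        rw [sq, sum_mul_sum, sum_product]
    _ ≤ ∑ q ∈ Icc 1 n ×ˢ ((Q ×ˢ Q).filter fun p => p.1.Coprime p.2),
        ((q.1 : ℝ) ^ 2)⁻¹ * ((q.2.1 : ℝ)⁻¹ * (q.2.2 : ℝ)⁻¹) := by
        refine sum_le_sum_of_injOn (fun p => (p.1.gcd p.2, (p.1 / p.1.gcd p.2,
          p.2 / p.1.gcd p.2))) ?_ ?_ ?_ ?_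
        · rintro ⟨a, b⟩ _ ⟨c, d⟩ _ h
          simp only [Prod.mk.injEq] at h ⊢
          obtain ⟨h1, h2, h3⟩ := h
          constructor
          · rw [← Nat.div_mul_cancel (Nat.gcd_dvd_left a b), h2, h1,
              Nat.div_mul_cancel (Nat.gcd_dvd_left c d)]
          · rw [← Nat.div_mul_cancel (Nat.gcd_dvd_right a b), h3, h1,
              Nat.div_mul_cancel (Nat.gcd_dvd_right c d)]
        · rintro ⟨a, b⟩ h
          simp only [hQ, mem_product, mem_oddSquarefreeBelow, mem_filter, mem_Icc] at h ⊢
          obtain ⟨⟨a1, a2, a3⟩, b1, b2, b3⟩ := h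
          have hg : 0 < a.gcd b := Nat.gcd_pos_of_pos_left _ a2.pos
          have ha := Nat.div_dvd_of_dvd (Nat.gcd_dvd_left a b)
          have hb := Nat.div_dvd_of_dvd (Nat.gcd_dvd_right a b)
          exact ⟨⟨hg, (Nat.gcd_le_left _ a2.pos).trans a1.le⟩,
            ⟨⟨(Nat.div_le_self _ _).trans_lt a1, a2.of_dvd_nat ha, a3.squarefree_of_dvd ha⟩,
              (Nat.div_le_self _ _).trans_lt b1, b2.of_dvd_nat hb, b3.squarefree_of_dvd hb⟩,
            Nat.coprime_div_gcd_div_gcd hg⟩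
        · intros; positivity
        · rintro ⟨a, b⟩ h
          simp only [hQ, mem_product, mem_oddSquarefreeBelow] at h
          have hg : 0 < a.gcd b := Nat.gcd_pos_of_pos_left _ h.1.2.1.pos
          apply le_of_eq
          dsimp only
          rw [Nat.cast_div (Nat.gcd_dvd_left a b) (by positivity),
            Nat.cast_div (Nat.gcd_dvd_right a b) (by positivity)]
          field_simp
    _ = (∑ m ∈ Icc 1 n, ((m : ℝ) ^ 2)⁻¹) * ∑ p ∈ Q ×ˢ Q with p.1.Coprime p.2,
        (p.1 : ℝ)⁻¹ * (p.2 : ℝ)⁻¹ := by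
        rw [sum_mul_sum, sum_product]
    _ ≤ 2 * ∑ p ∈ Q ×ˢ Q with p.1.Coprime p.2, (p.1 : ℝ)⁻¹ * (p.2 : ℝ)⁻¹ := by
        gcongr
        exact sum_Icc_inv_sq_le n
    _ ≤ 2 * ∑ q ∈ (oddSquarefreeBelow (n ^ 2)).sigma fun l => l.divisors, ((q.1 : ℝ))⁻¹ := by
        gcongr
        refine sum_le_sum_of_injOn (fun p => ⟨p.1 * p.2, p.1⟩) ?_ ?_ ?_ ?_
        · rintro ⟨a, b⟩ h ⟨c, d⟩ _ h'
          simp only [hQ, mem_product, mem_oddSquarefreeBelow, coe_filter, Set.mem_ofPred_eq] at h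
          simp only [Sigma.mk.injEq, heq_eq_eq] at h'
          obtain ⟨h1, rfl⟩ := h'
          rw [Nat.eq_of_mul_eq_mul_left h.1.1.2.1.pos h1]
        · rintro ⟨a, b⟩ h
          simp only [hQ, mem_product, mem_oddSquarefreeBelow, mem_filter] at h
          obtain ⟨⟨⟨a1, a2, a3⟩, b1, b2, b3⟩, hab⟩ := h
          simp only [mem_sigma, mem_oddSquarefreeBelow, Nat.mem_divisors]
          refine ⟨⟨?_, a2.mul b2, (Nat.squarefree_mul hab).2 ⟨a3, b3⟩⟩, dvd_mul_right _ _,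
            (Nat.mul_pos a2.pos b2.pos).ne'⟩
          rw [sq]
          exact Nat.mul_lt_mul'' a1 b1
        · intros; positivity
        · rintro ⟨a, b⟩ _
          apply le_of_eq
          push_cast
          rw [mul_inv]
    _ = _ := by
        rw [sum_sigma]
        simp [div_eq_mul_inv]

theorem log_sq_le_sum_oddSquarefree (n : ℕ) :
    Real.log (n + 1) ^ 2 / 32 ≤
      ∑ l ∈ oddSquarefreeBelow ((2 * n) ^ 2), (#l.divisors : ℝ) / l := by
  have h1 := log_le_sum_odd_inv n
  have h2 := sum_odd_inv_le_two_mul (2 * n)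
  have h3 := sq_sum_oddSquarefree_inv_le (2 * n)
  have h4 : 0 ≤ Real.log (n + 1) := Real.log_nonneg (by linarith [n.cast_nonneg (α := ℝ)])
  have h5 : Real.log (n + 1) / 4 ≤ ∑ a ∈ oddSquarefreeBelow (2 * n), (a : ℝ)⁻¹ := by linarith
  have h6 := pow_le_pow_left₀ (by positivity) h5 2
  linarith

theorem abs_card_modEq_sub_le (N c : ℕ) {r : ℕ} (hr : 0 < r) :
    |(#{n ∈ range N | n ≡ c [MOD r]} : ℝ) - N / r| ≤ 1 := by
  have h := Nat.count_modEq_card N hr c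
  rw [Nat.count_eq_card_filter_range] at h
  have h1 : (N : ℝ) = r * (N / r : ℕ) + (N % r : ℕ) := by exact_mod_cast (Nat.div_add_mod N r).symm
  have h2 : ((N % r : ℕ) : ℝ) < r := by exact_mod_cast Nat.mod_lt N hr
  have h3 : (0 : ℝ) < r := by exact_mod_cast hr
  have h4 : (N : ℝ) / r = (N / r : ℕ) + (N % r : ℕ) / r := by
    field_simp
    linarith
  have h5 : ((N % r : ℕ) : ℝ) / r ≤ 1 := (div_le_one h3).2 h2.le
  have h6 : (0 : ℝ) ≤ ((N % r : ℕ) : ℝ) / r := by positivity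
  rw [h, h4, abs_le]
  split_ifs
  · push_cast at *; constructor <;> linarith
  · push_cast at *; constructor <;> linarith

theorem abs_card_dvd_and_dvd_add_sub_le (N k : ℕ) {a b : ℕ} (ha : 0 < a) (hb : 0 < b)
    (hab : a.Coprime b) :
    |(#{n ∈ range N | a ∣ n ∧ b ∣ n + k} : ℝ) - N / (a * b : ℕ)| ≤ 1 := by
  obtain ⟨c, hc1, hc2⟩ := Nat.chineseRemainder hab 0 (b * k - k)
  have hk : k ≤ b * k := Nat.le_mul_of_pos_left k hb
  have : {n ∈ range N | a ∣ n ∧ b ∣ n + k} = {n ∈ range N | n ≡ c [MOD a * b]} := by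
    refine filter_congr fun n _ => ?_
    rw [← Nat.modEq_and_modEq_iff_modEq_mul hab]
    refine and_congr ?_ ?_
    · rw [← Nat.modEq_zero_iff_dvd]
      exact ⟨fun h => h.trans hc1.symm, fun h => h.trans hc1⟩
    · have h1 : b ∣ n + k ↔ n + k ≡ c + k [MOD b] := by
        have h2 : c + k ≡ 0 [MOD b] := by
          have := hc2.add_right k
          rw [Nat.sub_add_cancel hk] at this
          exact this.trans ((Nat.modEq_zero_iff_dvd).2 (dvd_mul_right _ _))
        rw [← Nat.modEq_zero_iff_dvd]
        exact ⟨fun h => h.trans h2.symm, fun h => h.trans h2⟩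
      rw [h1]
      exact ⟨fun h => h.add_right_cancel' k, fun h => h.add_right k⟩
  rw [this]
  exact abs_card_modEq_sub_le N c (Nat.mul_pos ha hb)

theorem ite_dvd_mul_add_two_eq_sum {d : ℕ} (hd : Odd d) (n : ℕ) :
    (if d ∣ n * (n + 2) then (1 : ℝ) else 0) =
      ∑ a ∈ d.divisors, if a ∣ n ∧ d / a ∣ n + 2 then 1 else 0 := by
  have hco : ∀ e, e ∣ d → e ∣ n → e ∣ n + 2 → e = 1 := by
    intro e h0 h1 h2
    have h3 : e ∣ 2 := (Nat.dvd_add_right h1).1 h2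
    rcases (Nat.dvd_prime Nat.prime_two).1 h3 with h | h
    · exact h
    · subst h
      exact absurd h0 hd.not_two_dvd_nat
  split_ifs with h
  · rw [sum_eq_single (d.gcd n)]
    · rw [if_pos]
      refine ⟨Nat.gcd_dvd_right _ _, ?_⟩
      have hg : 0 < d.gcd n := Nat.gcd_pos_of_pos_left _ hd.pos
      have h1 : (d / d.gcd n).Coprime (n / d.gcd n) := Nat.coprime_div_gcd_div_gcd hg
      refine h1.dvd_of_dvd_mul_left ?_
      rw [← Nat.mul_dvd_mul_iff_left hg, Nat.mul_div_cancel' (Nat.gcd_dvd_left d n),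
        ← mul_assoc, Nat.mul_div_cancel' (Nat.gcd_dvd_right d n)]
      exact h
    · intro a ha hne
      have had := Nat.dvd_of_mem_divisors ha
      refine if_neg fun ⟨h1, h2⟩ => hne ?_
      refine Nat.dvd_antisymm (Nat.dvd_gcd had h1) ?_
      have h3 : (d.gcd n).Coprime (d / a) := by
        refine hco _ ((Nat.gcd_dvd_right _ _).trans (Nat.div_dvd_of_dvd had))
          ((Nat.gcd_dvd_left _ _).trans (Nat.gcd_dvd_right _ _))
          ((Nat.gcd_dvd_right _ _).trans h2)
      refine h3.dvd_of_dvd_mul_right ?_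
      rw [Nat.mul_div_cancel' had]
      exact Nat.gcd_dvd_left _ _
    · intro h'
      exact absurd (Nat.mem_divisors.2 ⟨Nat.gcd_dvd_left _ _, hd.pos.ne'⟩) h'
  · refine (sum_eq_zero fun a ha => if_neg fun ⟨h1, h2⟩ => h ?_).symm
    rw [← Nat.mul_div_cancel' (Nat.dvd_of_mem_divisors ha)]
    exact mul_dvd_mul h1 h2

/-- The product of the odd primes below `z`. -/
def oddPrimorial (z : ℕ) : ℕ := ∏ p ∈ range z with p.Prime ∧ p ≠ 2, p

theorem squarefree_oddPrimorial (z : ℕ) : Squarefree (oddPrimorial z) := by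
  refine Finset.squarefree_prod_of_pairwise_isCoprime ?_ ?_
  · intro p hp q hq hpq
    simp only [coe_filter, Set.mem_ofPred_eq] at hp hq
    exact Nat.coprime_iff_isRelPrime.1 ((Nat.coprime_primes hp.2.1 hq.2.1).2 hpq)
  · intro p hp
    exact (mem_filter.1 hp).2.1.squarefree

theorem Nat.Prime.dvd_oddPrimorial_iff {p : ℕ} (hp : p.Prime) (z : ℕ) :
    p ∣ oddPrimorial z ↔ p < z ∧ p ≠ 2 := by
  rw [oddPrimorial, hp.prime.dvd_finsetProd_iff]
  constructor
  · rintro ⟨q, hq, hpq⟩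
    simp only [mem_filter, mem_range] at hq
    rw [(Nat.prime_dvd_prime_iff_eq hp hq.2.1).1 hpq]
    exact ⟨hq.1, hq.2.2⟩
  · rintro ⟨h1, h2⟩
    exact ⟨p, by simp [h1, h2, hp], dvd_rfl⟩

theorem odd_oddPrimorial (z : ℕ) : Odd (oddPrimorial z) := by
  rw [← Nat.not_even_iff_odd, even_iff_two_dvd, Nat.prime_two.dvd_oddPrimorial_iff]
  simp

/-- The sieve removing from the numbers `n * (n + 2)` with `n < N` the multiples of odd primes
below `z`. -/
noncomputable def twinSieve (N z : ℕ) : BoundingSieve where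
  support := (range N).image fun n => n * (n + 2)
  prodPrimes := oddPrimorial z
  prodPrimes_squarefree := squarefree_oddPrimorial z
  weights _ := 1
  weights_nonneg _ := zero_le_one
  totalMass := N
  nu := (σ 0 : ArithmeticFunction ℝ).pdiv (ArithmeticFunction.id : ArithmeticFunction ℝ)
  nu_mult := isMultiplicative_sigma.natCast.pdiv isMultiplicative_id.natCast
  nu_pos_of_prime p hp _ := by
    have := hp.pos
    simp [pdiv_apply, sigma_zero_apply, hp.divisors, this, hp.one_lt.ne]
  nu_lt_one_of_prime p hp h := by
    have h2 := (hp.dvd_oddPrimorial_iff z).1 h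
    have h3 : 2 < p := lt_of_le_of_ne hp.two_le h2.2.symm
    have h4 : (2 : ℝ) < p := by exact_mod_cast h3
    have h5 : (0 : ℝ) < p := by linarith
    simp [pdiv_apply, sigma_zero_apply, hp.divisors, card_pair hp.one_lt.ne, div_lt_one h5, h4]

variable {N z : ℕ}

theorem twinSieve_nu (d : ℕ) : (twinSieve N z).nu d = #d.divisors / d := by
  simp [twinSieve, pdiv_apply, sigma_zero_apply]

theorem injective_mul_add_two : Function.Injective fun n : ℕ => n * (n + 2) :=
  StrictMono.injective fun a b h => Nat.mul_lt_mul'' h (by omega)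

theorem abs_twinSieve_rem_le {d : ℕ} (hd : d ∣ (twinSieve N z).prodPrimes) :
    |(twinSieve N z).rem d| ≤ d := by
  have hsq := BoundingSieve.squarefree_of_dvd_prodPrimes hd
  have hodd : Odd d := (odd_oddPrimorial z).of_dvd_nat hd
  have h1 : (twinSieve N z).multSum d =
      ∑ a ∈ d.divisors, (#{n ∈ range N | a ∣ n ∧ d / a ∣ n + 2} : ℝ) := by
    simp only [BoundingSieve.multSum, twinSieve]
    rw [sum_image injective_mul_add_two.injOn]
    simp_rw [ite_dvd_mul_add_two_eq_sum hodd]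
    rw [sum_comm]
    simp
  have h2 : (twinSieve N z).rem d =
      ∑ a ∈ d.divisors, ((#{n ∈ range N | a ∣ n ∧ d / a ∣ n + 2} : ℝ) - N / (a * (d / a) : ℕ)) := by
    rw [BoundingSieve.rem, h1, sum_sub_distrib, twinSieve_nu]
    congr 1
    have : ∀ a ∈ d.divisors, (N : ℝ) / (a * (d / a) : ℕ) = N / d := fun a ha => by
      rw [Nat.mul_div_cancel' (Nat.dvd_of_mem_divisors ha)]
    rw [sum_congr rfl this]
    simp only [twinSieve, sum_const, nsmul_eq_mul]
    ring
  rw [h2]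
  calc _ ≤ ∑ a ∈ d.divisors, (1 : ℝ) := by
        refine (abs_sum_le_sum_abs _ _).trans (sum_le_sum fun a ha => ?_)
        have had := Nat.dvd_of_mem_divisors ha
        have hdd := Nat.mul_div_cancel' had
        refine abs_card_dvd_and_dvd_add_sub_le N 2 (Nat.pos_of_mem_divisors ha)
          (Nat.div_pos (Nat.le_of_dvd hodd.pos had) (Nat.pos_of_mem_divisors ha)) ?_
        exact Nat.coprime_of_squarefree_mul (hdd.symm ▸ hsq)
    _ ≤ d := by
        simp only [sum_const, nsmul_eq_mul, mul_one]
        exact_mod_cast Nat.card_divisors_le_self d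

theorem twinSieve_inv_nu_mul_selbergTerms_le {d : ℕ} (hd : d ∣ (twinSieve N z).prodPrimes) :
    ((twinSieve N z).nu d)⁻¹ * (twinSieve N z).selbergTerms d ≤ d := by
  have hsq := BoundingSieve.squarefree_of_dvd_prodPrimes hd
  rw [BoundingSieve.selbergTerms_apply, inv_mul_cancel_left₀ (BoundingSieve.nu_ne_zero hd)]
  calc _ ≤ ∏ p ∈ d.primeFactors, (p : ℝ) := by
        refine prod_le_prod ?_ ?_
        · intro p hp
          have := (twinSieve N z).nu_lt_one_of_prime p (Nat.prime_of_mem_primeFactors hp)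
            ((Nat.dvd_of_mem_primeFactors hp).trans hd)
          exact inv_nonneg.2 (by linarith)
        · intro p hp
          have hp' := Nat.prime_of_mem_primeFactors hp
          have h2 := (hp'.dvd_oddPrimorial_iff z).1 ((Nat.dvd_of_mem_primeFactors hp).trans hd)
          have h3 : 2 < p := lt_of_le_of_ne hp'.two_le h2.2.symm
          have h4 : (3 : ℝ) ≤ p := by exact_mod_cast h3
          rw [twinSieve_nu, hp'.divisors, card_pair hp'.one_lt.ne]
          have h6 : 1 - ((2 : ℕ) : ℝ) / p = (p - 2) / p := by
            push_cast
            field_simp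
          rw [h6, inv_div, div_le_iff₀ (by linarith)]
          nlinarith
    _ = d := by
        rw [← Nat.cast_prod, Nat.prod_primeFactors_of_squarefree hsq]

theorem twinSieve_nu_le_selbergTerms {d : ℕ} (hd : d ∣ (twinSieve N z).prodPrimes) :
    (twinSieve N z).nu d ≤ (twinSieve N z).selbergTerms d := by
  rw [BoundingSieve.selbergTerms_apply]
  refine le_mul_of_one_le_right (BoundingSieve.nu_pos_of_dvd_prodPrimes hd).le ?_
  refine Finset.one_le_prod fun p hp => ?_
  have hp' := Nat.prime_of_mem_primeFactors hp
  have hpd := (Nat.dvd_of_mem_primeFactors hp).trans hd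
  have h1 := (twinSieve N z).nu_lt_one_of_prime p hp' hpd
  have h2 := (twinSieve N z).nu_pos_of_prime p hp' hpd
  exact (one_le_inv₀ (by linarith)).2 (by linarith)

theorem dvd_oddPrimorial_of_mem {l : ℕ} (hl : l ∈ oddSquarefreeBelow z) : l ∣ oddPrimorial z := by
  obtain ⟨h1, h2, h3⟩ := mem_oddSquarefreeBelow.1 hl
  rw [← Nat.prod_primeFactors_of_squarefree h3]
  refine prod_dvd_prod_of_subset _ _ _ fun p hp => ?_
  have hpl := Nat.dvd_of_mem_primeFactors hp
  simp only [mem_filter, mem_range]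
  refine ⟨(Nat.le_of_dvd h2.pos hpl).trans_lt h1, Nat.prime_of_mem_primeFactors hp, ?_⟩
  rintro rfl
  exact h2.not_two_dvd_nat hpl

theorem log_sq_le_twinSieve_selbergSum (N n : ℕ) :
    Real.log (n + 1) ^ 2 / 32 ≤ (twinSieve N ((2 * n) ^ 2)).selbergSum ((2 * n) ^ 2) := by
  refine (log_sq_le_sum_oddSquarefree n).trans ?_
  have hdvd : ∀ l ∈ oddSquarefreeBelow ((2 * n) ^ 2),
      l ∣ (twinSieve N ((2 * n) ^ 2)).prodPrimes := fun l hl => dvd_oddPrimorial_of_mem hl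
  calc _ ≤ ∑ l ∈ oddSquarefreeBelow ((2 * n) ^ 2),
        (twinSieve N ((2 * n) ^ 2)).selbergTerms l := by
        refine sum_le_sum fun l hl => ?_
        rw [← twinSieve_nu (N := N) (z := (2 * n) ^ 2)]
        exact twinSieve_nu_le_selbergTerms (hdvd l hl)
    _ ≤ _ := by
        refine sum_le_sum_of_subset_of_nonneg (fun l hl => ?_) fun l hl _ => ?_
        · simp only [mem_filter, Nat.mem_divisors]
          exact ⟨⟨hdvd l hl, BoundingSieve.prodPrimes_ne_zero⟩, (mem_oddSquarefreeBelow.1 hl).1.le⟩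
        · exact (BoundingSieve.selbergTerms_pos (Nat.dvd_of_mem_divisors (mem_filter.1 hl).1)).le

theorem card_twinPrimes_le_siftedSum (N z : ℕ) :
    (#{p ∈ Ico z N | p.Prime ∧ (p + 2).Prime} : ℝ) ≤ (twinSieve N z).siftedSum := by
  have h : (twinSieve N z).siftedSum =
      #{n ∈ range N | (oddPrimorial z).Coprime (n * (n + 2))} := by
    rw [← sum_boole]
    exact sum_image injective_mul_add_two.injOn
  rw [h]
  refine Nat.cast_le.2 (card_le_card fun p hp => ?_)
  simp only [mem_filter, mem_Ico, mem_range] at hp ⊢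
  obtain ⟨⟨h1, h2⟩, h3, h4⟩ := hp
  refine ⟨h2, Nat.Coprime.mul_right ?_ ?_⟩
  · refine ((h3.coprime_iff_not_dvd).2 fun h => ?_).symm
    have := (h3.dvd_oddPrimorial_iff z).1 h
    omega
  · refine ((h4.coprime_iff_not_dvd).2 fun h => ?_).symm
    have := (h4.dvd_oddPrimorial_iff z).1 h
    omega

/-- The sieve bound for the number of twin primes, with a free parameter `n`. -/
theorem card_twinPrimes_le (N : ℕ) {n : ℕ} (hn : 0 < n) :
    (#{p ∈ Ico ((2 * n) ^ 2) N | p.Prime ∧ (p + 2).Prime} : ℝ) ≤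
      32 * N / Real.log (n + 1) ^ 2 + (2 * n) ^ 20 := by
  have hz : 1 ≤ (2 * n) ^ 2 := Nat.one_le_pow _ _ (by omega)
  have hlog : 0 < Real.log (n + 1) := Real.log_pos (by
    have : (0 : ℝ) < n := by exact_mod_cast hn
    linarith)
  have h := (card_twinPrimes_le_siftedSum N ((2 * n) ^ 2)).trans
    (BoundingSieve.siftedSum_le_div_selbergSum hz
      (fun d hd => twinSieve_inv_nu_mul_selbergTerms_le hd) fun d hd => abs_twinSieve_rem_le hd)
  refine h.trans (add_le_add ?_ ?_)
  · calc _ ≤ (N : ℝ) / (Real.log (n + 1) ^ 2 / 32) := by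
          have := log_sq_le_twinSieve_selbergSum N n
          exact div_le_div_of_nonneg_left N.cast_nonneg (by positivity) this
      _ = _ := by field_simp
  · push_cast
    rw [← pow_mul]

theorem exists_sum_twinPrimes_block_le : ∃ C : ℝ, ∀ k : ℕ,
    ∑ p ∈ Ico (((2 : ℕ) ^ 24) ^ (k + 1)) ((2 ^ 24) ^ (k + 2)) with p.Prime ∧ (p + 2).Prime,
      (1 / (p : ℝ)) ≤ C / (k + 1) ^ 2 := by
  have hl2 : 0 < Real.log 2 := Real.log_pos one_lt_two
  refine ⟨32 * 2 ^ 24 / Real.log 2 ^ 2 + 2 ^ 20, fun k => ?_⟩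
  set M : ℕ := 2 ^ 24 with hM_def
  have hM : (M : ℝ) = 2 ^ 24 := by rw [hM_def]; norm_num
  have hn : 0 < 2 ^ (k + 1) := by positivity
  have h := card_twinPrimes_le (M ^ (k + 2)) hn
  have hzM : (2 * 2 ^ (k + 1)) ^ 2 ≤ M ^ (k + 1) := by
    rw [← pow_succ', ← pow_mul, ← pow_mul]
    exact Nat.pow_le_pow_right two_pos (by omega)
  have hlog : (k + 1) * Real.log 2 ≤ Real.log ((2 ^ (k + 1) : ℕ) + 1) := by
    rw [show ((k : ℝ) + 1) * Real.log 2 = Real.log (2 ^ (k + 1)) by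
      rw [Real.log_pow]; push_cast; rfl]
    refine Real.log_le_log (by positivity) ?_
    push_cast
    linarith
  have hk : ((k : ℝ) + 1) ^ 2 ≤ 2 ^ (4 * (k + 1)) := by
    have : k + 1 < 2 ^ (k + 1) := Nat.lt_two_pow_self
    have h1 : (k : ℝ) + 1 ≤ 2 ^ (k + 1) := by exact_mod_cast this.le
    calc _ ≤ ((2 : ℝ) ^ (k + 1)) ^ 2 := by gcongr
      _ = 2 ^ (2 * (k + 1)) := by rw [← pow_mul, mul_comm]
      _ ≤ _ := pow_le_pow_right₀ one_le_two (by omega)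
  have hMk : (0 : ℝ) < (M : ℝ) ^ (k + 1) := by positivity
  calc _ ≤ ∑ p ∈ Ico (M ^ (k + 1)) (M ^ (k + 2)) with p.Prime ∧ (p + 2).Prime,
        (1 / (M : ℝ) ^ (k + 1)) := by
        refine sum_le_sum fun p hp => ?_
        simp only [mem_filter, mem_Ico] at hp
        exact one_div_le_one_div_of_le hMk (by exact_mod_cast hp.1.1)
    _ = #{p ∈ Ico (M ^ (k + 1)) (M ^ (k + 2)) | p.Prime ∧ (p + 2).Prime} / (M : ℝ) ^ (k + 1) := by
        simp [div_eq_mul_inv]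
    _ ≤ (32 * (M ^ (k + 2) : ℕ) / ((k + 1) * Real.log 2) ^ 2 + (2 * 2 ^ (k + 1)) ^ 20) /
          (M : ℝ) ^ (k + 1) := by
        gcongr
        calc _ ≤ (#{p ∈ Ico ((2 * 2 ^ (k + 1)) ^ 2) (M ^ (k + 2)) |
                p.Prime ∧ (p + 2).Prime} : ℝ) := by
              exact_mod_cast card_le_card (filter_subset_filter _ (Ico_subset_Ico_left hzM))
          _ ≤ _ := h
          _ ≤ _ := by
              push_cast at hlog ⊢
              gcongr
    _ = 32 * M / ((k + 1) * Real.log 2) ^ 2 + 2 ^ 20 / 2 ^ (4 * (k + 1)) := by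
        rw [add_div]
        congr 1
        · push_cast
          rw [pow_succ (M : ℝ) (k + 1)]
          field_simp
        · have : (M : ℝ) ^ (k + 1) = 2 ^ (20 * (k + 1)) * 2 ^ (4 * (k + 1)) := by
            rw [← pow_add, hM, ← pow_mul]
            ring_nf
          rw [this, mul_pow, ← pow_mul, mul_comm (k + 1) 20]
          field_simp
    _ ≤ 32 * M / ((k + 1) * Real.log 2) ^ 2 + 2 ^ 20 / (k + 1) ^ 2 := by
        gcongr
    _ = _ := by
        rw [hM]
        field_simp

theorem summable_of_sum_Ico_pow_le {f b : ℕ → ℝ} (hf : ∀ n, 0 ≤ f n) {M : ℕ} (hM : 1 < M)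
    (hb : Summable b) (h : ∀ k, ∑ n ∈ Ico (M ^ (k + 1)) (M ^ (k + 2)), f n ≤ b k) :
    Summable f := by
  have hb0 : ∀ k, 0 ≤ b k := fun k => (sum_nonneg fun n _ => hf n).trans (h k)
  have h1 : ∀ k, ∑ n ∈ range (M ^ (k + 1)), f n ≤ ∑ n ∈ range M, f n + ∑ j ∈ range k, b j := by
    intro k
    induction k with
    | zero => simp
    | succ k ih =>
      rw [← sum_range_add_sum_Ico f (Nat.pow_le_pow_right hM.le (by omega : k + 1 ≤ k + 2)),
        sum_range_succ]
      linarith [h k]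
  refine summable_of_sum_range_le (c := ∑ n ∈ range M, f n + ∑' j, b j) hf fun n => ?_
  calc _ ≤ ∑ i ∈ range (M ^ (n + 1)), f i := by
        refine sum_le_sum_of_subset_of_nonneg (range_subset_range.2 ?_) fun i _ _ => hf i
        exact (Nat.lt_pow_self hM).le.trans (Nat.pow_le_pow_right hM.le n.le_succ)
    _ ≤ _ := h1 n
    _ ≤ _ := by
        gcongr
        exact hb.sum_le_tsum _ fun i _ => hb0 i

theorem summable_indicator_twinPrimes :
    Summable ({p : ℕ | p.Prime ∧ (p + 2).Prime}.indicator fun p => 1 / (p : ℝ)) := by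
  obtain ⟨C, hC⟩ := exists_sum_twinPrimes_block_le
  refine summable_of_sum_Ico_pow_le (M := 2 ^ 24) (b := fun k => C / ((k : ℝ) + 1) ^ 2)
    (fun n => Set.indicator_nonneg (fun _ _ => by positivity) n) (by norm_num) ?_ fun k => ?_
  · have h := ((summable_nat_add_iff 1).2
      (Real.summable_one_div_nat_pow.2 one_lt_two)).mul_left C
    refine h.congr fun k => ?_
    push_cast
    ring
  · refine le_of_eq_of_le ?_ (hC k)
    rw [sum_filter]
    exact sum_congr rfl fun p _ => by simp [Set.indicator_apply]

/-- **Brun's theorem**: the series defining Brun's constant converges, i.e. the sum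
over all primes `p` with `p + 2` also prime of `1/p + 1/(p+2)` is summable. -/
theorem brun_summable :
    Summable (fun p : {p : ℕ // p.Prime ∧ (p + 2).Prime} =>
      (1 / (p : ℝ) + 1 / ((p : ℝ) + 2))) := by
  have h : Summable fun p : {p : ℕ // p.Prime ∧ (p + 2).Prime} => 1 / (p : ℝ) :=
    summable_subtype_iff_indicator.2 summable_indicator_twinPrimes
  refine h.add (h.of_nonneg_of_le (fun p => by positivity) fun p => ?_)
  have : (0 : ℝ) < p := by exact_mod_cast p.2.1.pos
  exact one_div_le_one_div_of_le this (by linarith)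
end

section
/- Khinchin's theorem: for Lebesgue-almost every real number x, the partial quotients a₁(x), a₂(x), a₃(x), … of the continued fraction expansion x = [a₀; a₁, a₂, a₃, …] satisfy lim_{n→∞} (a₁(x) a₂(x) ⋯ a_n(x))^{1/n} = K₀, where K₀ = ∏_{m=1}^∞ (1 + 1/(m(m+2)))^{log m / log 2} is Khinchin's constant. -/
open Filter

/-- The Gauss map `y ↦ frac (1/y)` generating continued fraction expansions. -/
noncomputable def gaussMap (y : ℝ) : ℝ := Int.fract y⁻¹

/-- The `(i+1)`-st partial quotient `a_{i+1}(x)` of the continued fraction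
expansion `x = [a₀; a₁, a₂, …]`, obtained by iterating the Gauss map on the
fractional part of `x`:  `a_{i+1}(x) = ⌊1 / (gaussMap^[i] (frac x))⌋`. -/
noncomputable def partialQuotient (x : ℝ) (i : ℕ) : ℤ :=
  ⌊(gaussMap^[i] (Int.fract x))⁻¹⌋

section Birkhoff

open MeasureTheory Set Topology

variable {α : Type*}

/-- The running maximum `max_{1 ≤ k ≤ n + 1} birkhoffSum T f k`, defined recursively. -/
noncomputable def birkhoffMax (T : α → α) (f : α → ℝ) : ℕ → α → ℝ
  | 0 => f
  | n + 1 => fun x => f x + max 0 (birkhoffMax T f n (T x))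

theorem birkhoffMax_le_succ (T : α → α) (f : α → ℝ) (n : ℕ) (x : α) :
    birkhoffMax T f n x ≤ birkhoffMax T f (n + 1) x := by
  induction n generalizing x with
  | zero => simp [birkhoffMax]
  | succ n ih =>
    exact add_le_add_right (max_le_max_left 0 (ih (T x))) (f x)

theorem monotone_birkhoffMax (T : α → α) (f : α → ℝ) (x : α) :
    Monotone fun n => birkhoffMax T f n x :=
  monotone_nat_of_le_succ fun n => birkhoffMax_le_succ T f n x

theorem birkhoffSum_le_birkhoffMax (T : α → α) (f : α → ℝ) (n : ℕ) (x : α) :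
    birkhoffSum T f (n + 1) x ≤ birkhoffMax T f n x := by
  induction n generalizing x with
  | zero => simp [birkhoffMax]
  | succ n ih =>
    have h : birkhoffSum T f (n + 1 + 1) x = f x + birkhoffSum T f (n + 1) (T x) :=
      birkhoffSum_succ' T f (n + 1) x
    rw [h, birkhoffMax]
    have := ih (T x)
    have := le_max_right 0 (birkhoffMax T f n (T x))
    linarith

theorem bddAbove_range_birkhoffSum_comp (T : α → α) (f : α → ℝ) (x : α) :
    BddAbove (range fun n => birkhoffSum T f n (T x)) ↔
      BddAbove (range fun n => birkhoffSum T f n x) := by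
  constructor
  · rintro ⟨B, hB⟩
    refine ⟨max 0 (f x + B), ?_⟩
    rintro _ ⟨n, rfl⟩
    rcases n with _ | n
    · simp
    · simp only [birkhoffSum_succ']
      have := hB ⟨n, rfl⟩
      simp only at this
      exact le_max_of_le_right (by linarith)
  · rintro ⟨B, hB⟩
    refine ⟨B - f x, ?_⟩
    rintro _ ⟨n, rfl⟩
    have := hB ⟨n + 1, rfl⟩
    simp only [birkhoffSum_succ'] at this
    simp only
    linarith

theorem birkhoffSum_sub_const (T : α → α) (f : α → ℝ) (c : ℝ) (n : ℕ) (x : α) :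
    birkhoffSum T (fun y => f y - c) n x = birkhoffSum T f n x - n * c := by
  simp [birkhoffSum, Finset.sum_sub_distrib]

theorem birkhoffSum_const_sub (T : α → α) (f : α → ℝ) (c : ℝ) (n : ℕ) (x : α) :
    birkhoffSum T (fun y => c - f y) n x = n * c - birkhoffSum T f n x := by
  simp [birkhoffSum, Finset.sum_sub_distrib]

variable [MeasurableSpace α] {μ : Measure α} {T : α → α} {f : α → ℝ}

theorem integrable_birkhoffMax (hT : MeasurePreserving T μ μ) (hf : Integrable f μ) (n : ℕ) :
    Integrable (birkhoffMax T f n) μ := by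
  induction n with
  | zero => exact hf
  | succ n ih =>
    have h : Integrable (fun x => max 0 (birkhoffMax T f n (T x))) μ :=
      (integrable_zero α ℝ μ).sup (hT.integrable_comp_of_integrable ih)
    exact hf.add h

theorem measurable_birkhoffSum (hT : Measurable T) (hf : Measurable f) (n : ℕ) :
    Measurable (birkhoffSum T f n) := by
  unfold birkhoffSum
  exact Finset.measurable_sum _ fun k _ => hf.comp (hT.iterate k)

/-- The Birkhoff sums of a function of negative mean are almost everywhere bounded above. -/
theorem Ergodic.ae_bddAbove_birkhoffSum (hT : Ergodic T μ) (hfm : Measurable f)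
    (hf : Integrable f μ) (hneg : ∫ x, f x ∂μ < 0) :
    ∀ᵐ x ∂μ, BddAbove (range fun n => birkhoffSum T f n x) := by
  have hmeas : MeasurableSet {x | BddAbove (range fun n => birkhoffSum T f n x)} :=
    measurableSet_bddAbove_range fun n => measurable_birkhoffSum hT.measurable hfm n
  refine (hT.toPreErgodic.ae_mem_or_ae_notMem hmeas ?_).resolve_right fun hunb => ?_
  · ext x
    exact bddAbove_range_birkhoffSum_comp T f x
  have hmp := hT.toMeasurePreserving
  have hlim : Tendsto (fun n => ∫ x, (birkhoffMax T f (n + 1) x - birkhoffMax T f n (T x)) ∂μ)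
      atTop (𝓝 (∫ x, f x ∂μ)) := by
    refine tendsto_integral_of_dominated_convergence (fun x => |f x| + |f (T x)|) (fun n => ?_)
      ?_ (fun n => ?_) ?_
    · exact ((integrable_birkhoffMax hmp hf (n + 1)).sub
        (hmp.integrable_comp_of_integrable
          (integrable_birkhoffMax hmp hf n))).aestronglyMeasurable
    · exact hf.abs.add (hmp.integrable_comp_of_integrable hf.abs)
    · refine ae_of_all _ fun x => ?_
      have h0 : f (T x) ≤ birkhoffMax T f n (T x) := monotone_birkhoffMax T f (T x) n.zero_le
      rw [birkhoffMax, Real.norm_eq_abs]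
      have := neg_abs_le (f (T x))
      have := neg_abs_le (f x)
      have := le_abs_self (f x)
      have := abs_nonneg (f (T x))
      rcases max_cases 0 (birkhoffMax T f n (T x)) with h | h <;>
        (rw [abs_le]; constructor <;> linarith)
    · filter_upwards [hunb] with x hx
      have hx' : ¬ BddAbove (range fun n => birkhoffSum T f n (T x)) := by
        rw [bddAbove_range_birkhoffSum_comp]
        exact hx
      obtain ⟨N, hN⟩ : ∃ N, 0 ≤ birkhoffMax T f N (T x) := by
        by_contra! hcon
        refine hx' ⟨0, ?_⟩
        rintro _ ⟨n, rfl⟩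
        rcases n with _ | n
        · simp
        · exact (birkhoffSum_le_birkhoffMax T f n (T x)).trans (hcon n).le
      refine tendsto_const_nhds.congr' ?_
      filter_upwards [eventually_ge_atTop N] with n hn
      have hn0 : 0 ≤ birkhoffMax T f n (T x) := hN.trans (monotone_birkhoffMax T f (T x) hn)
      simp only [birkhoffMax, max_eq_right hn0, add_sub_cancel_right]
  refine hneg.not_ge (ge_of_tendsto' hlim fun n => ?_)
  have hcompi : Integrable (fun x => birkhoffMax T f n (T x)) μ :=
    hmp.integrable_comp_of_integrable (integrable_birkhoffMax hmp hf n)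
  rw [integral_sub (integrable_birkhoffMax hmp hf (n + 1)) hcompi, sub_nonneg]
  have hcomp : ∫ x, birkhoffMax T f n (T x) ∂μ = ∫ x, birkhoffMax T f n x ∂μ := by
    have hint : AEStronglyMeasurable (birkhoffMax T f n) (μ.map T) := by
      rw [hmp.map_eq]
      exact (integrable_birkhoffMax hmp hf n).aestronglyMeasurable
    rw [← integral_map hmp.aemeasurable hint, hmp.map_eq]
  rw [hcomp]
  exact integral_mono (integrable_birkhoffMax hmp hf n) (integrable_birkhoffMax hmp hf (n + 1))
    (birkhoffMax_le_succ T f n)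

/-- **Birkhoff's pointwise ergodic theorem** for ergodic probability-preserving maps. -/
theorem Ergodic.ae_tendsto_birkhoffSum_div [IsProbabilityMeasure μ] (hT : Ergodic T μ)
    (hfm : Measurable f) (hf : Integrable f μ) :
    ∀ᵐ x ∂μ, Tendsto (fun n : ℕ => birkhoffSum T f n x / n) atTop (𝓝 (∫ y, f y ∂μ)) := by
  set I := ∫ y, f y ∂μ with hI
  have hupper (k : ℕ) : ∀ᵐ x ∂μ, BddAbove (range fun n =>
      birkhoffSum T (fun y => f y - (I + 1 / ((k : ℝ) + 1))) n x) := by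
    refine hT.ae_bddAbove_birkhoffSum (hfm.sub_const _) (hf.sub (integrable_const _)) ?_
    rw [integral_sub hf (integrable_const _)]
    have : (0 : ℝ) < 1 / ((k : ℝ) + 1) := by positivity
    simp only [integral_const, probReal_univ, smul_eq_mul, one_mul]
    linarith
  have hlower (k : ℕ) : ∀ᵐ x ∂μ, BddAbove (range fun n =>
      birkhoffSum T (fun y => (I - 1 / ((k : ℝ) + 1)) - f y) n x) := by
    refine hT.ae_bddAbove_birkhoffSum (hfm.const_sub _) ((integrable_const _).sub hf) ?_
    rw [integral_sub (integrable_const _) hf]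
    have : (0 : ℝ) < 1 / ((k : ℝ) + 1) := by positivity
    simp only [integral_const, probReal_univ, smul_eq_mul, one_mul]
    linarith
  filter_upwards [ae_all_iff.2 hupper, ae_all_iff.2 hlower] with x hu hl
  rw [Metric.tendsto_atTop']
  intro ε hε
  obtain ⟨k, hk⟩ := exists_nat_one_div_lt (half_pos hε)
  obtain ⟨B, hB⟩ := hu k
  obtain ⟨C, hC⟩ := hl k
  obtain ⟨N, hN⟩ := exists_nat_gt (max B C / (ε / 2))
  refine ⟨N, fun n hn => ?_⟩
  have h1 := hB ⟨n, rfl⟩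
  have h2 := hC ⟨n, rfl⟩
  simp only [birkhoffSum_sub_const] at h1
  simp only [birkhoffSum_const_sub] at h2
  have hn0 : (0 : ℝ) < n := by exact_mod_cast N.zero_le.trans_lt hn
  have hnN : (N : ℝ) < n := by exact_mod_cast hn
  have h3 : max B C < n * (ε / 2) := by
    rw [div_lt_iff₀ (half_pos hε)] at hN
    nlinarith
  have h4 := le_max_left B C
  have h5 := le_max_right B C
  have h6 : (n : ℝ) * (1 / ((k : ℝ) + 1)) < n * (ε / 2) := by gcongr
  rw [Real.dist_eq, abs_lt]
  constructor
  · rw [lt_sub_iff_add_lt, lt_div_iff₀ hn0]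
    linarith
  · rw [sub_lt_iff_lt_add, div_lt_iff₀ hn0]
    linarith

end Birkhoff

section Transfer

open Set Topology

/-- The weight of the branch `y ↦ (k + 1 + y)⁻¹` of the Gauss map in its transfer operator. -/
noncomputable def gaussWeight (k : ℕ) (x : ℝ) : ℝ := (1 + x) / ((k + 1 + x) * (k + 2 + x))

/-- The tail sums `∑_{j ≥ k} gaussWeight j x`. -/
noncomputable def gaussTail (k : ℕ) (x : ℝ) : ℝ := (1 + x) / (k + 1 + x)

/-- The transfer operator of the Gauss map with respect to the Gauss measure. -/
noncomputable def gaussTransfer (f : ℝ → ℝ) (x : ℝ) : ℝ :=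
  ∑' k : ℕ, gaussWeight k x * f (k + 1 + x)⁻¹

theorem gaussWeight_nonneg (k : ℕ) {x : ℝ} (hx : 0 ≤ x) : 0 ≤ gaussWeight k x := by
  unfold gaussWeight
  positivity

theorem gaussWeight_eq_gaussTail_sub (k : ℕ) {x : ℝ} (hx : 0 ≤ x) :
    gaussWeight k x = gaussTail k x - gaussTail (k + 1) x := by
  unfold gaussWeight gaussTail
  have h1 : (k : ℝ) + 1 + x ≠ 0 := by positivity
  have h2 : (k : ℝ) + 2 + x ≠ 0 := by positivity
  have h3 : (k : ℝ) + 1 + 1 + x ≠ 0 := by positivity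
  push_cast
  field_simp
  ring

theorem gaussTail_zero {x : ℝ} (hx : 0 ≤ x) : gaussTail 0 x = 1 := by
  have h : (1 : ℝ) + x ≠ 0 := by positivity
  simp [gaussTail, div_self h]

theorem tendsto_gaussTail (x : ℝ) : Tendsto (fun k => gaussTail k x) atTop (𝓝 0) := by
  unfold gaussTail
  refine tendsto_const_nhds.div_atTop ?_
  refine tendsto_atTop_add_const_right _ _ (tendsto_atTop_add_const_right _ _ ?_)
  exact tendsto_natCast_atTop_atTop

theorem hasSum_gaussWeight {x : ℝ} (hx : 0 ≤ x) : HasSum (fun k => gaussWeight k x) 1 := by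
  rw [hasSum_iff_tendsto_nat_of_nonneg fun k => gaussWeight_nonneg k hx]
  simp_rw [fun k => gaussWeight_eq_gaussTail_sub k hx, Finset.sum_range_sub', gaussTail_zero hx]
  simpa using (tendsto_gaussTail x).const_sub 1

/-- Nonnegative functions on `[0, ∞)` bounded by `C` and Lipschitz with constant `K`. -/
structure IsBoundedLipschitz (K C : ℝ) (f : ℝ → ℝ) : Prop where
  measurable : Measurable f
  nonneg : ∀ x, 0 ≤ x → 0 ≤ f x
  le : ∀ x, 0 ≤ x → f x ≤ C
  abs_sub_le : ∀ x y, 0 ≤ x → 0 ≤ y → |f x - f y| ≤ K * |x - y|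

variable {K C : ℝ} {f : ℝ → ℝ}

theorem IsBoundedLipschitz.const_nonneg (hf : IsBoundedLipschitz K C f) : 0 ≤ K := by
  have := hf.abs_sub_le 1 0 zero_le_one le_rfl
  simp only [sub_zero, abs_one, mul_one] at this
  exact (abs_nonneg _).trans this

theorem IsBoundedLipschitz.summable (hf : IsBoundedLipschitz K C f) {x : ℝ} (hx : 0 ≤ x) :
    Summable fun k : ℕ => gaussWeight k x * f (k + 1 + x)⁻¹ := by
  refine Summable.of_nonneg_of_le
    (fun k => mul_nonneg (gaussWeight_nonneg k hx) (hf.nonneg _ (by positivity)))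
    (fun k => ?_) ((hasSum_gaussWeight hx).summable.mul_right C)
  exact mul_le_mul_of_nonneg_left (hf.le _ (by positivity)) (gaussWeight_nonneg k hx)

theorem sum_gaussWeight_div_le (N : ℕ) {x y : ℝ} (hx : 0 ≤ x) (hy : 0 ≤ y) :
    ∑ k ∈ Finset.range N, gaussWeight k x / ((k + 1 + x) * (k + 1 + y)) ≤ 5 / 8 := by
  have hsucc (N : ℕ) : ∑ k ∈ Finset.range (N + 1),
      gaussWeight k x / ((k + 1 + x) * (k + 1 + y)) ≤ 5 / 8 - gaussTail (N + 1) x / 4 := by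
    induction N with
    | zero =>
      simp only [zero_add, Finset.range_one, Finset.sum_singleton, gaussWeight, gaussTail]
      push_cast
      have h1 : (1 + x) / ((0 + 1 + x) * (0 + 2 + x)) / ((0 + 1 + x) * (0 + 1 + y)) ≤
          1 / (2 + x) := by
        rw [div_div, div_le_div_iff₀ (by positivity) (by positivity)]
        have : 0 ≤ (1 + x) * (2 + x) * (x * y + x + y) := by positivity
        nlinarith
      have h2 : 1 / (2 + x) ≤ 5 / 8 - (1 + x) / (1 + 1 + x) / 4 := by
        rw [le_sub_iff_add_le, div_div, div_add_div _ _ (by positivity) (by positivity),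
          div_le_div_iff₀ (by positivity) (by positivity)]
        nlinarith [mul_nonneg hx hx]
      exact h1.trans h2
    | succ N ih =>
      rw [Finset.sum_range_succ]
      have h : gaussWeight (N + 1) x /
          (((N + 1 : ℕ) + 1 + x) * ((N + 1 : ℕ) + 1 + y)) ≤ gaussWeight (N + 1) x / 4 := by
        refine div_le_div_of_nonneg_left (gaussWeight_nonneg _ hx) (by norm_num) ?_
        push_cast
        have hN : (0 : ℝ) ≤ N := N.cast_nonneg
        nlinarith [mul_nonneg hN hx, mul_nonneg hN hy, mul_nonneg hx hy, mul_nonneg hN hN]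
      have h' := gaussWeight_eq_gaussTail_sub (N + 1) hx
      linarith
  rcases N with _ | N
  · norm_num
  · have : 0 ≤ gaussTail (N + 1) x := by
      unfold gaussTail
      positivity
    linarith [hsucc N]

theorem abs_inv_sub_inv {u v : ℝ} (hu : 0 < u) (hv : 0 < v) :
    |u⁻¹ - v⁻¹| = |u - v| / (u * v) := by
  rw [inv_sub_inv hu.ne' hv.ne', abs_div, abs_sub_comm, abs_of_pos (mul_pos hu hv)]

theorem sum_inv_mul_mul_le (N : ℕ) :
    ∑ k ∈ Finset.range N, 1 / (((k : ℝ) + 1) * (k + 2) * (k + 3)) ≤ 1 / 4 := by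
  have h : ∑ k ∈ Finset.range N, 1 / (((k : ℝ) + 1) * (k + 2) * (k + 3)) =
      1 / 4 - 1 / (2 * (((N : ℝ) + 1) * (N + 2))) := by
    induction N with
    | zero => norm_num
    | succ N ih =>
      rw [Finset.sum_range_succ, ih]
      push_cast
      field_simp
      ring
  have : (0 : ℝ) ≤ 1 / (2 * (((N : ℝ) + 1) * (N + 2))) := by positivity
  linarith

theorem abs_gaussTail_sub_le (k : ℕ) {x y : ℝ} (hx : 0 ≤ x) (hy : 0 ≤ y) :
    |gaussTail (k + 1) x - gaussTail (k + 1) y| ≤ (k + 1) / (k + 2) ^ 2 * |x - y| := by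
  have h : gaussTail (k + 1) x - gaussTail (k + 1) y =
      (k + 1) / ((k + 2 + x) * (k + 2 + y)) * (x - y) := by
    unfold gaussTail
    push_cast
    have h1 : (k : ℝ) + 1 + 1 + x ≠ 0 := by positivity
    have h2 : (k : ℝ) + 1 + 1 + y ≠ 0 := by positivity
    have h3 : (k : ℝ) + 2 + x ≠ 0 := by positivity
    have h4 : (k : ℝ) + 2 + y ≠ 0 := by positivity
    field_simp
    ring
  rw [h, abs_mul, abs_of_nonneg (by positivity)]
  gcongr
  rw [sq]
  exact mul_le_mul (by linarith) (by linarith) (by positivity) (by positivity)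

theorem sum_gaussWeight_sub_mul (g : ℕ → ℝ) (N : ℕ) {x y : ℝ} (hx : 0 ≤ x) (hy : 0 ≤ y) :
    ∑ k ∈ Finset.range N, (gaussWeight k x - gaussWeight k y) * g k =
      ∑ k ∈ Finset.range N, (gaussTail (k + 1) x - gaussTail (k + 1) y) * (g (k + 1) - g k) -
        (gaussTail N x - gaussTail N y) * g N := by
  induction N with
  | zero => simp [gaussTail_zero hx, gaussTail_zero hy]
  | succ N ih =>
    rw [Finset.sum_range_succ, Finset.sum_range_succ, ih, gaussWeight_eq_gaussTail_sub N hx,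
      gaussWeight_eq_gaussTail_sub N hy]
    ring

theorem IsBoundedLipschitz.abs_sum_sub_sum_le (hf : IsBoundedLipschitz K C f) (N : ℕ) {x y : ℝ}
    (hx : 0 ≤ x) (hy : 0 ≤ y) :
    |∑ k ∈ Finset.range N, gaussWeight k x * f (k + 1 + x)⁻¹ -
        ∑ k ∈ Finset.range N, gaussWeight k y * f (k + 1 + y)⁻¹| ≤
      7 / 8 * K * |x - y| + |gaussTail N x - gaussTail N y| * C := by
  have hK := hf.const_nonneg
  have hsplit : ∑ k ∈ Finset.range N, gaussWeight k x * f (k + 1 + x)⁻¹ -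
        ∑ k ∈ Finset.range N, gaussWeight k y * f (k + 1 + y)⁻¹ =
      ∑ k ∈ Finset.range N, gaussWeight k x * (f (k + 1 + x)⁻¹ - f (k + 1 + y)⁻¹) +
        ∑ k ∈ Finset.range N, (gaussWeight k x - gaussWeight k y) * f (k + 1 + y)⁻¹ := by
    rw [← Finset.sum_sub_distrib, ← Finset.sum_add_distrib]
    exact Finset.sum_congr rfl fun k _ => by ring
  have h1 : |∑ k ∈ Finset.range N, gaussWeight k x * (f (k + 1 + x)⁻¹ - f (k + 1 + y)⁻¹)| ≤
      5 / 8 * (K * |x - y|) := by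
    refine (Finset.abs_sum_le_sum_abs _ _).trans ?_
    refine le_trans ?_
      (mul_le_mul_of_nonneg_right (sum_gaussWeight_div_le N hx hy) (by positivity))
    rw [Finset.sum_mul]
    refine Finset.sum_le_sum fun k _ => ?_
    rw [abs_mul, abs_of_nonneg (gaussWeight_nonneg k hx), div_mul_eq_mul_div, mul_div_assoc]
    refine mul_le_mul_of_nonneg_left ?_ (gaussWeight_nonneg k hx)
    refine (hf.abs_sub_le _ _ (by positivity) (by positivity)).trans_eq ?_
    rw [abs_inv_sub_inv (by positivity) (by positivity), add_sub_add_left_eq_sub, mul_div_assoc]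
  have h2 : |∑ k ∈ Finset.range N, (gaussTail (k + 1) x - gaussTail (k + 1) y) *
      (f ((k + 1 : ℕ) + 1 + y)⁻¹ - f (k + 1 + y)⁻¹)| ≤ 1 / 4 * (K * |x - y|) := by
    refine (Finset.abs_sum_le_sum_abs _ _).trans ?_
    refine le_trans ?_ (mul_le_mul_of_nonneg_right (sum_inv_mul_mul_le N) (by positivity))
    rw [Finset.sum_mul]
    refine Finset.sum_le_sum fun k _ => ?_
    have hg : |f ((k + 1 : ℕ) + 1 + y)⁻¹ - f (k + 1 + y)⁻¹| ≤
        K * (1 / ((k + 1) * (k + 2))) := by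
      refine (hf.abs_sub_le _ _ (by positivity) (by positivity)).trans ?_
      rw [abs_inv_sub_inv (by positivity) (by positivity)]
      refine mul_le_mul_of_nonneg_left ?_ hK
      have : ((k + 1 : ℕ) : ℝ) + 1 + y - (k + 1 + y) = 1 := by
        push_cast
        ring
      rw [this, abs_one, mul_comm ((k : ℝ) + 1)]
      push_cast
      exact one_div_le_one_div_of_le (by positivity)
        (mul_le_mul (by linarith) (by linarith) (by positivity) (by positivity))
    rw [abs_mul]
    refine (mul_le_mul (abs_gaussTail_sub_le k hx hy) hg (abs_nonneg _)
      (by positivity)).trans ?_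
    have : ((k : ℝ) + 1) / (k + 2) ^ 2 * |x - y| * (K * (1 / ((k + 1) * (k + 2)))) =
        1 / ((k : ℝ) + 2) ^ 3 * (K * |x - y|) := by
      field_simp
    rw [this]
    gcongr
    nlinarith [(k.cast_nonneg : (0 : ℝ) ≤ k)]
  have h3 : |(gaussTail N x - gaussTail N y) * f (N + 1 + y)⁻¹| ≤
      |gaussTail N x - gaussTail N y| * C := by
    rw [abs_mul, abs_of_nonneg (hf.nonneg _ (by positivity))]
    exact mul_le_mul_of_nonneg_left (hf.le _ (by positivity)) (abs_nonneg _)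
  rw [hsplit, sum_gaussWeight_sub_mul (fun k => f (k + 1 + y)⁻¹) N hx hy]
  refine (abs_add_le _ _).trans ((add_le_add h1 ((abs_sub _ _).trans (add_le_add h2 h3))).trans_eq ?_)
  ring

/-- The transfer operator of the Gauss map contracts Lipschitz constants. -/
theorem IsBoundedLipschitz.gaussTransfer (hf : IsBoundedLipschitz K C f) :
    IsBoundedLipschitz (7 / 8 * K) C (gaussTransfer f) where
  measurable := by
    have := hf.measurable
    refine Measurable.tsum fun k => ?_
    unfold gaussWeight
    fun_prop
  nonneg x hx :=
    tsum_nonneg fun k => mul_nonneg (gaussWeight_nonneg k hx) (hf.nonneg _ (by positivity))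
  le x hx := by
    have hC := (hasSum_gaussWeight hx).mul_right C
    rw [one_mul] at hC
    rw [← hC.tsum_eq]
    refine (hf.summable hx).tsum_le_tsum (fun k => ?_) hC.summable
    exact mul_le_mul_of_nonneg_left (hf.le _ (by positivity)) (gaussWeight_nonneg k hx)
  abs_sub_le x y hx hy := by
    have h1 := ((hf.summable hx).hasSum.tendsto_sum_nat.sub
      (hf.summable hy).hasSum.tendsto_sum_nat).abs
    have h2 := (((tendsto_gaussTail x).sub (tendsto_gaussTail y)).abs.mul_const C).const_add
      (7 / 8 * K * |x - y|)
    simp only [sub_zero, abs_zero, zero_mul, add_zero] at h2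
    exact le_of_tendsto_of_tendsto' h1 h2 fun N => hf.abs_sum_sub_sum_le N hx hy

theorem IsBoundedLipschitz.iterate_gaussTransfer (hf : IsBoundedLipschitz K C f) (n : ℕ) :
    IsBoundedLipschitz ((7 / 8) ^ n * K) C (_root_.gaussTransfer^[n] f) := by
  induction n with
  | zero => simpa using hf
  | succ n ih =>
    rw [Function.iterate_succ_apply', pow_succ', mul_assoc]
    exact ih.gaussTransfer

end Transfer

section GaussMeasure

open MeasureTheory Set Topology

/-- The density of the Gauss measure. -/
noncomputable def gaussDensity (x : ℝ) : ℝ := (Real.log 2)⁻¹ * (1 + x)⁻¹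

/-- The Gauss measure, an invariant probability measure of the Gauss map. -/
noncomputable def gaussMeasure : Measure ℝ :=
  (volume.restrict (Ioc 0 1)).withDensity fun x => ENNReal.ofReal (gaussDensity x)

theorem measurable_gaussDensity : Measurable gaussDensity := by
  unfold gaussDensity
  fun_prop

theorem gaussDensity_pos {x : ℝ} (hx : 0 ≤ x) : 0 < gaussDensity x := by
  have := Real.log_pos one_lt_two
  unfold gaussDensity
  positivity

theorem measurable_gaussMap : Measurable gaussMap :=
  measurable_fract.comp measurable_inv

theorem integral_gaussDensity {a b : ℝ} (ha : 0 ≤ a) (hab : a ≤ b) :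
    ∫ x in Ioc a b, gaussDensity x = (Real.log 2)⁻¹ * Real.log ((1 + b) / (1 + a)) := by
  rw [← intervalIntegral.integral_of_le hab]
  unfold gaussDensity
  rw [intervalIntegral.integral_const_mul,
    intervalIntegral.integral_comp_add_left (fun x => x⁻¹) 1, integral_inv_of_pos] <;> linarith

theorem integrableOn_gaussDensity {a b : ℝ} (ha : 0 ≤ a) :
    IntegrableOn gaussDensity (Ioc a b) := by
  refine (ContinuousOn.integrableOn_Icc ?_).mono_set Ioc_subset_Icc_self
  unfold gaussDensity
  refine continuousOn_const.mul (ContinuousOn.inv₀ (by fun_prop) fun x hx => ?_)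
  have := ha.trans hx.1
  positivity

theorem gaussMeasure_Ioc {a b : ℝ} (ha : 0 ≤ a) (hab : a ≤ b) (hb : b ≤ 1) :
    gaussMeasure (Ioc a b) =
      ENNReal.ofReal ((Real.log 2)⁻¹ * Real.log ((1 + b) / (1 + a))) := by
  rw [gaussMeasure, withDensity_apply _ measurableSet_Ioc,
    Measure.restrict_restrict measurableSet_Ioc,
    inter_eq_left.2 (Ioc_subset_Ioc ha hb), ← integral_gaussDensity ha hab,
    ofReal_integral_eq_lintegral_ofReal (integrableOn_gaussDensity ha)]
  exact (ae_restrict_mem measurableSet_Ioc).mono fun x hx =>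
    (gaussDensity_pos (ha.trans hx.1.le)).le

theorem ae_gaussMeasure_mem : ∀ᵐ x ∂gaussMeasure, x ∈ Ioc (0 : ℝ) 1 :=
  (withDensity_absolutelyContinuous _ _).ae_le (ae_restrict_mem measurableSet_Ioc)

theorem restrict_absolutelyContinuous_gaussMeasure :
    volume.restrict (Ioc (0 : ℝ) 1) ≪ gaussMeasure := by
  refine withDensity_absolutelyContinuous' measurable_gaussDensity.ennreal_ofReal.aemeasurable ?_
  filter_upwards [ae_restrict_mem measurableSet_Ioc] with x hx
  simpa using gaussDensity_pos hx.1.le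

instance : IsProbabilityMeasure gaussMeasure := by
  refine ⟨?_⟩
  have h : (univ : Set ℝ) =ᵐ[gaussMeasure] Ioc 0 1 := by
    filter_upwards [ae_gaussMeasure_mem] with x hx
    exact propext (iff_of_true (mem_univ x) hx)
  rw [measure_congr h, gaussMeasure_Ioc le_rfl zero_le_one le_rfl]
  norm_num

theorem inv_mem_Ioc_iff {k : ℕ} {x : ℝ} (hx : 0 < x) :
    x ∈ Ioc ((k : ℝ) + 2)⁻¹ ((k : ℝ) + 1)⁻¹ ↔ x⁻¹ - (k + 1) ∈ Ico (0 : ℝ) 1 := by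
  rw [mem_Ioc, mem_Ico, inv_lt_comm₀ (by positivity) hx, le_inv_comm₀ hx (by positivity),
    sub_nonneg, sub_lt_iff_lt_add']
  constructor <;> rintro ⟨h1, h2⟩ <;> constructor <;> linarith

theorem floor_inv_eq_of_mem {k : ℕ} {x : ℝ} (hx : x ∈ Ioc ((k : ℝ) + 2)⁻¹ ((k : ℝ) + 1)⁻¹) :
    ⌊x⁻¹⌋ = k + 1 := by
  have hx0 : 0 < x := lt_trans (by positivity) hx.1
  have h := (inv_mem_Ioc_iff hx0).1 hx
  rw [Int.floor_eq_iff]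
  push_cast
  constructor <;> linarith [h.1, h.2]

theorem pairwise_disjoint_Ioc_inv :
    Pairwise (Function.onFun Disjoint fun k : ℕ => Ioc ((k : ℝ) + 2)⁻¹ ((k : ℝ) + 1)⁻¹) := by
  intro j k hjk
  refine Set.disjoint_left.2 fun x hj hk => hjk ?_
  have := (floor_inv_eq_of_mem hj).symm.trans (floor_inv_eq_of_mem hk)
  omega

theorem iUnion_Ioc_inv : ⋃ k : ℕ, Ioc ((k : ℝ) + 2)⁻¹ ((k : ℝ) + 1)⁻¹ = Ioc (0 : ℝ) 1 := by
  ext x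
  rw [mem_iUnion]
  constructor
  · rintro ⟨k, hk⟩
    refine ⟨lt_trans (by positivity) hk.1, hk.2.trans (inv_le_one_of_one_le₀ ?_)⟩
    have : (0 : ℝ) ≤ k := k.cast_nonneg
    linarith
  · intro hx
    have h1 : 1 ≤ ⌊x⁻¹⌋₊ := by
      rw [Nat.one_le_floor_iff]
      exact (one_le_inv₀ hx.1).2 hx.2
    refine ⟨⌊x⁻¹⌋₊ - 1, (inv_mem_Ioc_iff hx.1).2 ?_⟩
    have h2 := Nat.floor_le (inv_nonneg.2 hx.1.le)
    have h3 := Nat.lt_floor_add_one x⁻¹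
    push_cast [h1]
    constructor <;> linarith

theorem image_inv_Ico (k : ℕ) :
    (fun y : ℝ => (k + 1 + y)⁻¹) '' Ico 0 1 = Ioc ((k : ℝ) + 2)⁻¹ ((k : ℝ) + 1)⁻¹ := by
  ext x
  constructor
  · rintro ⟨y, hy, rfl⟩
    have h0 : 0 < (k : ℝ) + 1 + y := by linarith [hy.1, (k.cast_nonneg : (0 : ℝ) ≤ k)]
    rw [inv_mem_Ioc_iff (inv_pos.2 h0), inv_inv, add_sub_cancel_left]
    exact hy
  · intro hx
    have hx0 : 0 < x := lt_trans (by positivity) hx.1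
    refine ⟨x⁻¹ - (k + 1), (inv_mem_Ioc_iff hx0).1 hx, ?_⟩
    simp

theorem gaussMap_inv (k : ℕ) {y : ℝ} (hy : y ∈ Ico (0 : ℝ) 1) :
    gaussMap (k + 1 + y)⁻¹ = y := by
  have h : (k : ℝ) + 1 + y = y + ((k + 1 : ℕ) : ℝ) := by
    push_cast
    ring
  rw [gaussMap, inv_inv, h, Int.fract_add_natCast, Int.fract_eq_self.2 hy]

theorem lintegral_Ioc_eq_tsum (G : ℝ → ENNReal) :
    ∫⁻ x in Ioc 0 1, G x =
      ∑' k : ℕ, ∫⁻ y in Ico 0 1, ENNReal.ofReal ((k + 1 + y) ^ 2)⁻¹ * G (k + 1 + y)⁻¹ := by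
  rw [← iUnion_Ioc_inv, lintegral_iUnion (fun _ => measurableSet_Ioc) pairwise_disjoint_Ioc_inv]
  refine tsum_congr fun k => ?_
  have hpos : ∀ y ∈ Ico (0 : ℝ) 1, (k : ℝ) + 1 + y ≠ 0 := fun y hy => by
    have := hy.1
    positivity
  rw [← image_inv_Ico, lintegral_image_eq_lintegral_abs_deriv_mul measurableSet_Ico
    (f' := fun y => -1 / (k + 1 + y) ^ 2)]
  · refine setLIntegral_congr_fun measurableSet_Ico fun y _ => ?_
    rw [abs_div, abs_neg, abs_one, abs_of_nonneg (by positivity), one_div]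
  · intro y hy
    exact (((hasDerivAt_id y).const_add _).inv (hpos y hy)).hasDerivWithinAt
  · intro y _ z _ hyz
    simpa using hyz

theorem gaussDensity_inv (k : ℕ) {y : ℝ} (hy : 0 ≤ y) :
    ((k + 1 + y) ^ 2)⁻¹ * gaussDensity (k + 1 + y)⁻¹ = gaussDensity y * gaussWeight k y := by
  unfold gaussDensity gaussWeight
  have h1 : (k : ℝ) + 1 + y ≠ 0 := by positivity
  have h2 : (k : ℝ) + 2 + y ≠ 0 := by positivity
  have h3 : 1 + y ≠ 0 := by positivity
  have h4 : 1 + ((k : ℝ) + 1 + y)⁻¹ = (k + 2 + y) / (k + 1 + y) := by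
    field_simp
    ring
  rw [h4]
  field_simp

theorem lintegral_gaussMeasure {F : ℝ → ENNReal} (hF : Measurable F) :
    ∫⁻ x, F x ∂gaussMeasure = ∫⁻ x in Ioc 0 1, ENNReal.ofReal (gaussDensity x) * F x := by
  rw [gaussMeasure,
    lintegral_withDensity_eq_lintegral_mul _ measurable_gaussDensity.ennreal_ofReal hF]
  rfl

theorem measurable_gaussWeight (k : ℕ) : Measurable (gaussWeight k) := by
  unfold gaussWeight
  fun_prop

/-- The transfer operator is dual to composition with the Gauss map. -/
theorem setLIntegral_preimage_gaussMap {F : ℝ → ENNReal} (hF : Measurable F) {B : Set ℝ}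
    (hB : MeasurableSet B) :
    ∫⁻ x in gaussMap ⁻¹' B, F x ∂gaussMeasure =
      ∫⁻ y in B, ∑' k : ℕ, ENNReal.ofReal (gaussWeight k y) * F (k + 1 + y)⁻¹ ∂gaussMeasure := by
  have hw (k : ℕ) : Measurable fun y =>
      ENNReal.ofReal (gaussWeight k y) * F ((k : ℝ) + 1 + y)⁻¹ :=
    (measurable_gaussWeight k).ennreal_ofReal.mul (hF.comp (by fun_prop))
  have hsum : Measurable fun y : ℝ =>
      ∑' k : ℕ, ENNReal.ofReal (gaussWeight k y) * F ((k : ℝ) + 1 + y)⁻¹ :=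
    Measurable.tsum hw
  rw [← lintegral_indicator (measurable_gaussMap hB), ← lintegral_indicator hB,
    lintegral_gaussMeasure (hF.indicator (measurable_gaussMap hB)),
    lintegral_gaussMeasure (hsum.indicator hB), lintegral_Ioc_eq_tsum,
    ← Measure.restrict_congr_set (Ico_ae_eq_Ioc (a := (0 : ℝ)) (b := 1)),
    ← lintegral_tsum]
  · refine setLIntegral_congr_fun measurableSet_Ico fun y hy => ?_
    by_cases hyB : y ∈ B
    · rw [indicator_of_mem hyB, ← ENNReal.tsum_mul_left]
      refine tsum_congr fun k => ?_
      have hmem : ((k : ℝ) + 1 + y)⁻¹ ∈ gaussMap ⁻¹' B := by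
        rwa [mem_preimage, gaussMap_inv k hy]
      rw [indicator_of_mem hmem, ← mul_assoc, ← mul_assoc,
        ← ENNReal.ofReal_mul (by positivity), gaussDensity_inv k hy.1,
        ENNReal.ofReal_mul (gaussDensity_pos hy.1).le]
    · rw [indicator_of_notMem hyB, mul_zero, ENNReal.tsum_eq_zero]
      intro k
      have hmem : ((k : ℝ) + 1 + y)⁻¹ ∉ gaussMap ⁻¹' B := by
        rwa [mem_preimage, gaussMap_inv k hy]
      rw [indicator_of_notMem hmem, mul_zero, mul_zero]
  · intro k
    have h := measurable_gaussDensity.ennreal_ofReal.mul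
      (hF.indicator (measurable_gaussMap hB))
    exact (Measurable.mul (by fun_prop) (h.comp (by fun_prop))).aemeasurable

theorem measurePreserving_gaussMap : MeasurePreserving gaussMap gaussMeasure gaussMeasure := by
  refine ⟨measurable_gaussMap, ?_⟩
  ext B hB
  rw [Measure.map_apply measurable_gaussMap hB, ← setLIntegral_one, ← setLIntegral_one B,
    setLIntegral_preimage_gaussMap measurable_const hB]
  refine setLIntegral_congr_fun_ae hB ?_
  filter_upwards [ae_gaussMeasure_mem] with y hy _
  have hs := hasSum_gaussWeight hy.1.le
  simp only [mul_one]
  rw [← ENNReal.ofReal_tsum_of_nonneg (fun k => gaussWeight_nonneg k hy.1.le) hs.summable,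
    hs.tsum_eq, ENNReal.ofReal_one]

variable {K C : ℝ} {f : ℝ → ℝ}

theorem IsBoundedLipschitz.ae_nonneg (hf : IsBoundedLipschitz K C f) : 0 ≤ᵐ[gaussMeasure] f := by
  filter_upwards [ae_gaussMeasure_mem] with x hx
  exact hf.nonneg x hx.1.le

theorem IsBoundedLipschitz.integrable (hf : IsBoundedLipschitz K C f) :
    Integrable f gaussMeasure := by
  refine .of_bound hf.measurable.aestronglyMeasurable C ?_
  filter_upwards [ae_gaussMeasure_mem] with x hx
  rw [Real.norm_of_nonneg (hf.nonneg x hx.1.le)]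
  exact hf.le x hx.1.le

theorem IsBoundedLipschitz.setIntegral_gaussTransfer (hf : IsBoundedLipschitz K C f)
    {A : Set ℝ} (hA : MeasurableSet A) (hinv : gaussMap ⁻¹' A = A) :
    ∫ x in A, _root_.gaussTransfer f x ∂gaussMeasure = ∫ x in A, f x ∂gaussMeasure := by
  rw [integral_eq_lintegral_of_nonneg_ae (ae_restrict_of_ae hf.gaussTransfer.ae_nonneg)
      hf.gaussTransfer.measurable.aestronglyMeasurable,
    integral_eq_lintegral_of_nonneg_ae (ae_restrict_of_ae hf.ae_nonneg)
      hf.measurable.aestronglyMeasurable]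
  congr 1
  conv_rhs => rw [← hinv, setLIntegral_preimage_gaussMap hf.measurable.ennreal_ofReal hA]
  refine setLIntegral_congr_fun_ae hA ?_
  filter_upwards [ae_gaussMeasure_mem] with y hy _
  have hy0 := hy.1.le
  rw [_root_.gaussTransfer, ENNReal.ofReal_tsum_of_nonneg
    (fun k => mul_nonneg (gaussWeight_nonneg k hy0) (hf.nonneg _ (by positivity)))
    (hf.summable hy0)]
  exact tsum_congr fun k => ENNReal.ofReal_mul (gaussWeight_nonneg k hy0)

theorem IsBoundedLipschitz.setIntegral_iterate_gaussTransfer (hf : IsBoundedLipschitz K C f)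
    {A : Set ℝ} (hA : MeasurableSet A) (hinv : gaussMap ⁻¹' A = A) (n : ℕ) :
    ∫ x in A, _root_.gaussTransfer^[n] f x ∂gaussMeasure = ∫ x in A, f x ∂gaussMeasure := by
  induction n with
  | zero => rfl
  | succ n ih =>
    rw [Function.iterate_succ_apply', (hf.iterate_gaussTransfer n).setIntegral_gaussTransfer hA
      hinv, ih]

theorem IsBoundedLipschitz.abs_setIntegral_sub_le (hf : IsBoundedLipschitz K C f) (A : Set ℝ) :
    |∫ x in A, f x ∂gaussMeasure - gaussMeasure.real A * f 1| ≤ K := by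
  have hint : IntegrableOn f A gaussMeasure := hf.integrable.integrableOn
  have h : ∫ x in A, f x ∂gaussMeasure - gaussMeasure.real A * f 1 =
      ∫ x in A, (f x - f 1) ∂gaussMeasure := by
    rw [integral_sub hint (integrable_const _)]
    simp
  rw [h]
  have hK : ∀ᵐ x ∂gaussMeasure.restrict A, ‖f x - f 1‖ ≤ K := by
    refine ae_restrict_of_ae ?_
    filter_upwards [ae_gaussMeasure_mem] with x hx
    refine (hf.abs_sub_le x 1 hx.1.le zero_le_one).trans
      (mul_le_of_le_one_right hf.const_nonneg ?_)
    rw [abs_le]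
    constructor <;> linarith [hx.1, hx.2]
  refine (norm_integral_le_of_norm_le_const hK).trans
    (mul_le_of_le_one_right hf.const_nonneg ?_)
  simpa using measureReal_le_one

theorem IsBoundedLipschitz.setIntegral_eq_mul (hf : IsBoundedLipschitz K C f)
    {A : Set ℝ} (hA : MeasurableSet A) (hinv : gaussMap ⁻¹' A = A) :
    ∫ x in A, f x ∂gaussMeasure = gaussMeasure.real A * ∫ x, f x ∂gaussMeasure := by
  have hbound (n : ℕ) : |∫ x in A, f x ∂gaussMeasure -
      gaussMeasure.real A * ∫ x, f x ∂gaussMeasure| ≤ 2 * ((7 / 8) ^ n * K) := by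
    have hn := hf.iterate_gaussTransfer n
    have h1 := hn.abs_setIntegral_sub_le A
    have h2 := hn.abs_setIntegral_sub_le univ
    rw [hf.setIntegral_iterate_gaussTransfer hA hinv] at h1
    rw [hf.setIntegral_iterate_gaussTransfer .univ preimage_univ, setIntegral_univ,
      probReal_univ, one_mul] at h2
    have h3 : gaussMeasure.real A * |∫ x, f x ∂gaussMeasure - _root_.gaussTransfer^[n] f 1| ≤
        (7 / 8) ^ n * K :=
      (mul_le_of_le_one_left (abs_nonneg _) measureReal_le_one).trans h2
    rw [← abs_of_nonneg (measureReal_nonneg (μ := gaussMeasure) (s := A)), ← abs_mul,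
      mul_sub] at h3
    have h4 := _root_.abs_sub_le (∫ x in A, f x ∂gaussMeasure)
      (gaussMeasure.real A * _root_.gaussTransfer^[n] f 1)
      (gaussMeasure.real A * ∫ x, f x ∂gaussMeasure)
    rw [abs_sub_comm] at h3
    linarith
  have hlim : Tendsto (fun n : ℕ => 2 * ((7 / 8 : ℝ) ^ n * K)) atTop (𝓝 0) := by
    simpa using ((tendsto_pow_atTop_nhds_zero_of_lt_one (by norm_num) (by norm_num)).mul_const
      K).const_mul (2 : ℝ)
  have := ge_of_tendsto' hlim hbound
  exact sub_eq_zero.1 (abs_nonpos_iff.1 this)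

theorem isBoundedLipschitz_thickenedIndicator {δ : ℝ} (hδ : 0 < δ) (F : Set ℝ) :
    IsBoundedLipschitz δ⁻¹ 1 fun x => (thickenedIndicator hδ F x : ℝ) where
  measurable := (NNReal.continuous_coe.comp (thickenedIndicator hδ F).continuous).measurable
  nonneg _ _ := NNReal.coe_nonneg _
  le x _ := by exact_mod_cast thickenedIndicator_le_one hδ F x
  abs_sub_le x y _ _ := by
    have := (lipschitzWith_thickenedIndicator hδ F).dist_le_mul x y
    rwa [NNReal.dist_eq, Real.dist_eq, NNReal.coe_inv, Real.coe_toNNReal δ hδ.le] at this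

theorem gaussMeasure_real_inter_of_isClosed {A F : Set ℝ} (hA : MeasurableSet A)
    (hinv : gaussMap ⁻¹' A = A) (hF : IsClosed F) :
    gaussMeasure.real (F ∩ A) = gaussMeasure.real A * gaussMeasure.real F := by
  have hpos (n : ℕ) : (0 : ℝ) < 1 / ((n : ℝ) + 1) := Nat.one_div_pos_of_nat
  have h1 := tendsto_integral_thickenedIndicator_of_isClosed (gaussMeasure.restrict A) hF hpos
    tendsto_one_div_add_atTop_nhds_zero_nat
  have h2 := (tendsto_integral_thickenedIndicator_of_isClosed gaussMeasure hF hpos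
    tendsto_one_div_add_atTop_nhds_zero_nat).const_mul (gaussMeasure.real A)
  simp_rw [fun n => (isBoundedLipschitz_thickenedIndicator (hpos n) F).setIntegral_eq_mul hA
    hinv] at h1
  rw [← tendsto_nhds_unique h1 h2, measureReal_restrict_apply hF.measurableSet]

theorem ergodic_gaussMap : Ergodic gaussMap gaussMeasure where
  toMeasurePreserving := measurePreserving_gaussMap
  aeconst_set := by
    intro A hA hinv
    have hext : gaussMeasure.restrict A = gaussMeasure A • gaussMeasure := by
      have hclosed (F : Set ℝ) (hF : IsClosed F) :
          gaussMeasure.restrict A F = (gaussMeasure A • gaussMeasure) F := by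
        rw [Measure.restrict_apply hF.measurableSet, Measure.smul_apply, smul_eq_mul,
          ← ENNReal.toReal_eq_toReal_iff' (by finiteness) (by finiteness), ENNReal.toReal_mul]
        exact gaussMeasure_real_inter_of_isClosed hA hinv hF
      refine ext_of_generate_finite _ ?_ isPiSystem_isClosed hclosed
        (hclosed univ isClosed_univ)
      rw [BorelSpace.measurable_eq (α := ℝ), borel_eq_generateFrom_isClosed]
    have h0 : gaussMeasure A * gaussMeasure Aᶜ = 0 := by
      have := congrArg (fun m : Measure ℝ => m Aᶜ) hext
      simpa [Measure.restrict_apply hA.compl] using this.symm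
    rw [eventuallyConst_set']
    rcases mul_eq_zero.1 h0 with h | h
    · exact Or.inl (ae_eq_empty.2 h)
    · exact Or.inr (ae_eq_univ.2 h)

end GaussMeasure

section Khinchin

open MeasureTheory Set Topology

/-- The contribution of the digit `m` to the logarithm of Khinchin's constant. -/
noncomputable def khinchinTerm (m : ℕ) : ℝ :=
  Real.log m / Real.log 2 * Real.log (1 + 1 / ((m : ℝ) * ((m : ℝ) + 2)))

theorem khinchinTerm_nonneg (m : ℕ) : 0 ≤ khinchinTerm m :=
  mul_nonneg (div_nonneg (Real.log_natCast_nonneg m) (Real.log_nonneg one_le_two))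
    (Real.log_nonneg (le_add_of_nonneg_right (by positivity)))

theorem summable_khinchinTerm : Summable khinchinTerm := by
  have hlog2 : 0 < Real.log 2 := Real.log_pos one_lt_two
  have hs : Summable fun m : ℕ => 2 / Real.log 2 * ((m : ℝ) ^ (3 / 2 : ℝ))⁻¹ :=
    (Real.summable_nat_rpow_inv.2 (by norm_num)).mul_left _
  refine Summable.of_nonneg_of_le khinchinTerm_nonneg (fun m => ?_) hs
  rcases m.eq_zero_or_pos with rfl | hm
  · simp [khinchinTerm]
  have hm' : (0 : ℝ) < m := by exact_mod_cast hm
  have h1 : Real.log m ≤ 2 * (m : ℝ) ^ (1 / 2 : ℝ) := by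
    have := Real.log_le_rpow_div hm'.le (ε := 1 / 2) (by norm_num)
    linarith
  have h2 : Real.log (1 + 1 / ((m : ℝ) * ((m : ℝ) + 2))) ≤ ((m : ℝ) ^ (2 : ℝ))⁻¹ := by
    have h3 : (0 : ℝ) < 1 + 1 / ((m : ℝ) * ((m : ℝ) + 2)) := by positivity
    refine (Real.log_le_sub_one_of_pos h3).trans ?_
    rw [add_sub_cancel_left, one_div, Real.rpow_two, sq]
    gcongr
    linarith
  have h4 : (m : ℝ) ^ (1 / 2 : ℝ) * ((m : ℝ) ^ (2 : ℝ))⁻¹ = ((m : ℝ) ^ (3 / 2 : ℝ))⁻¹ := by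
    rw [← Real.rpow_neg hm'.le, ← Real.rpow_neg hm'.le, ← Real.rpow_add hm']
    norm_num
  calc khinchinTerm m
      ≤ 2 * (m : ℝ) ^ (1 / 2 : ℝ) / Real.log 2 * ((m : ℝ) ^ (2 : ℝ))⁻¹ := by
        unfold khinchinTerm
        refine mul_le_mul (by gcongr) h2 (Real.log_nonneg ?_) (by positivity)
        exact le_add_of_nonneg_right (by positivity)
    _ = 2 / Real.log 2 * ((m : ℝ) ^ (3 / 2 : ℝ))⁻¹ := by
        rw [← h4]
        ring

theorem exp_tsum_khinchinTerm :
    Real.exp (∑' k : ℕ, khinchinTerm (k + 1)) =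
      ∏' m : ℕ+, ((1 + 1 / ((m : ℝ) * ((m : ℝ) + 2))) ^
        (Real.log (m : ℝ) / Real.log 2)) := by
  have hpos (m : ℕ+) : (0 : ℝ) < 1 + 1 / ((m : ℝ) * ((m : ℝ) + 2)) := by positivity
  have hlog (m : ℕ+) : Real.log ((1 + 1 / ((m : ℝ) * ((m : ℝ) + 2))) ^
      (Real.log (m : ℝ) / Real.log 2)) = khinchinTerm m := Real.log_rpow (hpos m) _
  rw [← Real.rexp_tsum_eq_tprod (fun m => Real.rpow_pos_of_pos (hpos m) _)]
  · simp_rw [hlog]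
    rw [tsum_pnat_eq_tsum_succ (f := khinchinTerm)]
  · simp_rw [hlog]
    exact summable_khinchinTerm.comp_injective PNat.coe_injective

theorem gaussMeasure_real_Ioc_inv (k : ℕ) :
    gaussMeasure.real (Ioc ((k : ℝ) + 2)⁻¹ ((k : ℝ) + 1)⁻¹) =
      (Real.log 2)⁻¹ * Real.log (1 + 1 / (((k + 1 : ℕ) : ℝ) * (((k + 1 : ℕ) : ℝ) + 2))) := by
  have hk : (0 : ℝ) ≤ k := k.cast_nonneg
  have h : (1 + ((k : ℝ) + 1)⁻¹) / (1 + ((k : ℝ) + 2)⁻¹) =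
      1 + 1 / (((k + 1 : ℕ) : ℝ) * (((k + 1 : ℕ) : ℝ) + 2)) := by
    push_cast
    have h3 : (k : ℝ) + 1 + 2 ≠ 0 := by positivity
    have h4 : (k : ℝ) + 2 + 1 ≠ 0 := by positivity
    field_simp
    ring
  rw [measureReal_def, gaussMeasure_Ioc (by positivity)
    (inv_anti₀ (by positivity) (by linarith)) (inv_le_one_of_one_le₀ (by linarith)), h,
    ENNReal.toReal_ofReal]
  refine mul_nonneg (inv_nonneg.2 (Real.log_nonneg one_le_two)) (Real.log_nonneg ?_)
  exact le_add_of_nonneg_right (by positivity)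

/-- The logarithm of the first partial quotient. -/
noncomputable def logDigit (x : ℝ) : ℝ := Real.log ⌊x⁻¹⌋

theorem measurable_logDigit : Measurable logDigit := by
  have h : Measurable fun z : ℤ => Real.log z := measurable_from_top
  exact h.comp (Int.measurable_floor.comp measurable_inv)

theorem logDigit_eqOn (k : ℕ) :
    EqOn logDigit (fun _ => Real.log ((k + 1 : ℕ) : ℝ))
      (Ioc ((k : ℝ) + 2)⁻¹ ((k : ℝ) + 1)⁻¹) := by
  intro x hx
  rw [logDigit, floor_inv_eq_of_mem hx]
  push_cast
  rfl

theorem setIntegral_log_Ioc_inv (k : ℕ) :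
    ∫ _ in Ioc ((k : ℝ) + 2)⁻¹ ((k : ℝ) + 1)⁻¹, Real.log ((k + 1 : ℕ) : ℝ) ∂gaussMeasure =
      khinchinTerm (k + 1) := by
  rw [setIntegral_const, gaussMeasure_real_Ioc_inv, khinchinTerm, smul_eq_mul]
  ring

theorem integrableOn_logDigit :
    IntegrableOn logDigit (⋃ k : ℕ, Ioc ((k : ℝ) + 2)⁻¹ ((k : ℝ) + 1)⁻¹) gaussMeasure := by
  refine integrableOn_iUnion_of_summable_integral_norm (fun k => ?_) ?_
  · rw [integrableOn_congr_fun (logDigit_eqOn k) measurableSet_Ioc]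
    exact integrable_const _
  · refine ((summable_nat_add_iff 1).2 summable_khinchinTerm).congr fun k => ?_
    rw [← setIntegral_log_Ioc_inv]
    refine setIntegral_congr_fun measurableSet_Ioc fun x hx => ?_
    rw [logDigit_eqOn k hx, Real.norm_of_nonneg (Real.log_natCast_nonneg _)]

theorem restrict_iUnion_gaussMeasure :
    gaussMeasure.restrict (⋃ k : ℕ, Ioc ((k : ℝ) + 2)⁻¹ ((k : ℝ) + 1)⁻¹) = gaussMeasure := by
  rw [iUnion_Ioc_inv]
  exact Measure.restrict_eq_self_of_ae_mem ae_gaussMeasure_mem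

theorem integrable_logDigit : Integrable logDigit gaussMeasure := by
  have h := integrableOn_logDigit
  rwa [IntegrableOn, restrict_iUnion_gaussMeasure] at h

theorem integral_logDigit :
    ∫ x, logDigit x ∂gaussMeasure = ∑' k : ℕ, khinchinTerm (k + 1) := by
  have h := hasSum_integral_iUnion (fun _ => measurableSet_Ioc) pairwise_disjoint_Ioc_inv
    integrableOn_logDigit
  rw [restrict_iUnion_gaussMeasure] at h
  rw [← h.tsum_eq]
  refine tsum_congr fun k => ?_
  rw [setIntegral_congr_fun measurableSet_Ioc (logDigit_eqOn k), setIntegral_log_Ioc_inv]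

theorem ae_gaussMeasure_tendsto_geomMean :
    ∀ᵐ y ∂gaussMeasure, Tendsto
      (fun n : ℕ => (∏ i ∈ Finset.range n, (⌊(gaussMap^[i] y)⁻¹⌋ : ℝ)) ^ ((n : ℝ)⁻¹)) atTop
      (𝓝 (∏' m : ℕ+, ((1 + 1 / ((m : ℝ) * ((m : ℝ) + 2))) ^
        (Real.log (m : ℝ) / Real.log 2)))) := by
  have hmem : ∀ᵐ y ∂gaussMeasure, ∀ i : ℕ, gaussMap^[i] y ∈ Ioc (0 : ℝ) 1 :=
    ae_all_iff.2 fun i =>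
      (measurePreserving_gaussMap.iterate i).quasiMeasurePreserving.ae ae_gaussMeasure_mem
  filter_upwards [hmem,
    ergodic_gaussMap.ae_tendsto_birkhoffSum_div measurable_logDigit integrable_logDigit]
    with y hy hlim
  rw [← exp_tsum_khinchinTerm, ← integral_logDigit]
  refine ((Real.continuous_exp.tendsto _).comp hlim).congr fun n => ?_
  have hpos (i : ℕ) : (0 : ℝ) < ⌊(gaussMap^[i] y)⁻¹⌋ := by
    rw [Int.cast_pos, Int.floor_pos]
    exact (one_le_inv₀ (hy i).1).2 (hy i).2
  rw [Function.comp_apply, Real.rpow_def_of_pos (Finset.prod_pos fun i _ => hpos i),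
    Real.log_prod fun i _ => (hpos i).ne', div_eq_mul_inv]
  rfl

/-- A property that holds almost everywhere on `(0, 1]` holds for the fractional part of almost
every real number. -/
theorem ae_fract_of_ae_restrict_Ioc {P : ℝ → Prop}
    (h : ∀ᵐ y ∂volume.restrict (Ioc (0 : ℝ) 1), P y) : ∀ᵐ x : ℝ, P (Int.fract x) := by
  rw [← Measure.restrict_congr_set (Ico_ae_eq_Ioc (a := (0 : ℝ)) (b := 1)),
    ae_restrict_iff' measurableSet_Ico] at h
  have hshift : ∀ᵐ x : ℝ, ∀ n : ℤ, x - n ∈ Ico (0 : ℝ) 1 → P (x - n) :=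
    ae_all_iff.2 fun n => (measurePreserving_sub_right volume (n : ℝ)).quasiMeasurePreserving.ae h
  filter_upwards [hshift] with x hx
  exact hx ⌊x⌋ ⟨Int.fract_nonneg x, Int.fract_lt_one x⟩

end Khinchin

/-- **Khinchin's theorem**: for Lebesgue-almost every real `x`, the geometric means
of the partial quotients of the continued fraction of `x` converge to Khinchin's
constant `K₀ = ∏_{m=1}^∞ (1 + 1/(m(m+2)))^{log m / log 2}`. -/
theorem khinchin_theorem :
    ∀ᵐ x : ℝ, Tendsto
      (fun n : ℕ => (∏ i ∈ Finset.range n, (partialQuotient x i : ℝ)) ^ ((n : ℝ)⁻¹))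
      atTop
      (nhds (∏' m : ℕ+, ((1 + 1 / ((m : ℝ) * ((m : ℝ) + 2))) ^
        (Real.log (m : ℝ) / Real.log 2)))) := by
  exact ae_fract_of_ae_restrict_Ioc
    (restrict_absolutelyContinuous_gaussMeasure.ae_le ae_gaussMeasure_tendsto_geomMean)
end
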